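/- Let G be a minimal counterexample, let x be a vertex of degree 7 whose neighbors of degree 5 are exactly four in number and form a path u1u2u3u4 in G, and let v = u1 be an endpoint of this path. Then v has four neighbors of degree at least 7, among which at least two have degree at least 8. -/

import Mathlib

open SimpleGraph

variable {V : Type}

/-- The involution of the darts of a graph reversing each dart. -/
def dartRev (G : SimpleGraph V) : Equiv.Perm G.Dart :=
  Function.Involutive.toPerm SimpleGraph.Dart.symm SimpleGraph.Dart.symm_involutive

/-- The face permutation of a rotation system `σ`: it sends a dart `(u,v)` to `σ (v,u)`. -/
def facePerm {G : SimpleGraph V} (σ : Equiv.Perm G.Dart) : Equiv.Perm G.Dart :=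
  (dartRev G).trans σ

/-- The setoid on `α` whose classes are the orbits (cycles) of a permutation of `α`. -/
def orbitSetoid {α : Type*} (f : Equiv.Perm α) : Setoid α :=
  ⟨f.SameCycle, ⟨fun x => Equiv.Perm.SameCycle.refl f x, fun h => h.symm, fun h h' => h.trans h'⟩⟩

/-- The number of faces of a rotation system: the number of orbits of the face permutation. -/
noncomputable def numFaces {G : SimpleGraph V} (σ : Equiv.Perm G.Dart) : ℕ :=
  Nat.card (Quotient (orbitSetoid (facePerm σ)))

/-- The number of darts in the face (orbit of the face permutation) containing the dart `d`. -/
noncomputable def faceSize {G : SimpleGraph V} (σ : Equiv.Perm G.Dart) (d : G.Dart) : ℕ :=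
  Nat.card {e : G.Dart // (facePerm σ).SameCycle d e}

/-- `σ` is a rotation system on `G`: every dart and its image share their first vertex, and
the `σ`-orbit of every dart consists of all darts sharing its first vertex. -/
structure IsRotationSystem (G : SimpleGraph V) (σ : Equiv.Perm G.Dart) : Prop where
  fst_eq : ∀ d : G.Dart, (σ d).toProd.1 = d.toProd.1
  orbit_eq : ∀ d e : G.Dart, d.toProd.1 = e.toProd.1 → σ.SameCycle d e

/-- The degree of a vertex. -/
noncomputable def deg (G : SimpleGraph V) (v : V) : ℕ := Nat.card (G.neighborSet v)

/-- A plane triangulation: a finite connected simple graph on at least 4 vertices equipped with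
a rotation system satisfying Euler's formula `|V| - |E| + F = 2` in which every face consists of
exactly 3 darts. -/
structure IsPlaneTriangulation [Fintype V] (G : SimpleGraph V) (σ : Equiv.Perm G.Dart) :
    Prop where
  connected : G.Connected
  four_le_card : 4 ≤ Fintype.card V
  rot : IsRotationSystem G σ
  euler : Fintype.card V + numFaces σ = Nat.card G.edgeSet + 2
  face_size_eq : ∀ d : G.Dart, faceSize σ d = 3

/-- A proper 5-coloring (colors `0,...,4` standing for `1,...,5`). -/
def Proper5 (G : SimpleGraph V) (c : V → Fin 5) : Prop :=
  ∀ ⦃u w : V⦄, G.Adj u w → c u ≠ c w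

/-- A finite simple graph is planar if it is isomorphic to a subgraph of a plane triangulation. -/
def IsPlanar [Fintype V] (G : SimpleGraph V) : Prop :=
  ∃ (W : Type) (iW : Fintype W) (T : SimpleGraph W) (σ : Equiv.Perm T.Dart),
    @IsPlaneTriangulation W iW T σ ∧ ∃ f : G →g T, Function.Injective f

/-- `w` is the neighbor of `v` following `u` in the cyclic (counterclockwise) order
around `v` given by the rotation system `σ`. -/
def NextNbr {G : SimpleGraph V} (σ : Equiv.Perm G.Dart) (v u w : V) : Prop :=
  ∃ h : G.Adj v u, (σ ⟨(v, u), h⟩).toProd.2 = w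

/-- A minimal counterexample: a plane triangulation admitting no proper 5-coloring with some
color class of size at most `|V|/6`, while every planar graph on fewer vertices admits one. -/
def IsMinimalCounterexample [Fintype V] (G : SimpleGraph V) (σ : Equiv.Perm G.Dart) : Prop :=
  IsPlaneTriangulation G σ ∧
  (¬ ∃ c : V → Fin 5, Proper5 G c ∧
      ∃ k : Fin 5, 6 * Nat.card {v : V | c v = k} ≤ Fintype.card V) ∧
  (∀ (W : Type) [Fintype W] (H : SimpleGraph W), IsPlanar H →
      Fintype.card W < Fintype.card V →
      ∃ c : W → Fin 5, Proper5 H c ∧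
        ∃ k : Fin 5, 6 * Nat.card {w : W | c w = k} ≤ Fintype.card W)




/-- The neighbor of `v` following `w` in the rotation around `v`. -/
noncomputable def nx {G : SimpleGraph V} (σ : Equiv.Perm G.Dart) (v w : V) : V := by
  classical
  exact if h : G.Adj v w then (σ ⟨(v, w), h⟩).toProd.2 else w

section basics

variable {G : SimpleGraph V} {σ : Equiv.Perm G.Dart}

theorem sigma_eq (hR : IsRotationSystem G σ) {v w : V} (h : G.Adj v w) :
    ∃ h' : G.Adj v (nx σ v w), σ ⟨(v, w), h⟩ = ⟨(v, nx σ v w), h'⟩ := by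
  have h1 := hR.fst_eq ⟨(v, w), h⟩
  have h2 : nx σ v w = (σ ⟨(v, w), h⟩).toProd.2 := by simp [nx, h]
  generalize hd : σ ⟨(v, w), h⟩ = d at *
  obtain ⟨⟨a, b⟩, hab⟩ := d
  simp only at h1 h2
  subst h1
  subst h2
  exact ⟨hab, rfl⟩

theorem adj_nx (hR : IsRotationSystem G σ) {v w : V} (h : G.Adj v w) : G.Adj v (nx σ v w) :=
  (sigma_eq hR h).1

theorem adj_iter (hR : IsRotationSystem G σ) {v w : V} (h : G.Adj v w) (i : ℕ) :
    G.Adj v ((nx σ v)^[i] w) := by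
  induction i with
  | zero => exact h
  | succ i ih => rw [Function.iterate_succ_apply']; exact adj_nx hR ih

theorem sigma_iter (hR : IsRotationSystem G σ) {v w : V} (h : G.Adj v w) (i : ℕ) :
    σ^[i] ⟨(v, w), h⟩ = ⟨(v, (nx σ v)^[i] w), adj_iter hR h i⟩ := by
  induction i with
  | zero => rfl
  | succ i ih =>
    rw [Function.iterate_succ_apply', ih]
    obtain ⟨h', e⟩ := sigma_eq hR (adj_iter hR h i)
    rw [e]
    congr 2
    rw [Function.iterate_succ_apply']

theorem card_sameCycle {α : Type*} [Finite α] (f : Equiv.Perm α) (x : α) :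
    Nat.card {e // f.SameCycle x e} = Function.minimalPeriod f x := by
  classical
  have := Fintype.ofFinite α
  have h := MulAction.minimalPeriod_eq_card (a := f) (b := x)
  have : (fun y => f • y) = (f : α → α) := rfl
  rw [this] at h
  rw [h, ← Nat.card_eq_fintype_card]
  apply Nat.card_congr
  apply Equiv.subtypeEquivRight
  intro e
  constructor
  · rintro ⟨i, hi⟩
    exact ⟨⟨f ^ i, i, rfl⟩, hi⟩
  · rintro ⟨⟨_, i, rfl⟩, hi⟩
    exact ⟨i, hi⟩

theorem minPeriod_deg [Finite V] (hR : IsRotationSystem G σ) {v w : V} (h : G.Adj v w) :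
    Function.minimalPeriod σ ⟨(v, w), h⟩ = deg G v := by
  classical
  have : Finite G.Dart := by
    have := Fintype.ofFinite V
    infer_instance
  rw [← card_sameCycle, deg]
  apply Nat.card_congr
  have key : ∀ e : G.Dart, σ.SameCycle ⟨(v, w), h⟩ e ↔ e.toProd.1 = v := by
    intro e
    constructor
    · intro hs
      obtain ⟨i, _, _, rfl⟩ := hs.exists_pow_eq''
      rw [← Equiv.Perm.iterate_eq_pow, sigma_iter hR]
    · intro he
      exact hR.orbit_eq _ _ he.symm
  refine ⟨fun e => ⟨e.1.toProd.2, ?_⟩, fun y => ⟨⟨(v, y.1), y.2⟩, (key _).2 rfl⟩, ?_, ?_⟩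
  · have := (key e.1).1 e.2
    rw [mem_neighborSet]
    have h2 := e.1.adj
    generalize e.1.toProd.1 = z at this h2
    subst this
    exact h2
  · rintro ⟨⟨⟨a, b⟩, hab⟩, he⟩
    have := (key _).1 he
    simp only at this
    subst this
    rfl
  · rintro ⟨y, hy⟩
    rfl

theorem iter_deg [Finite V] (hR : IsRotationSystem G σ) {v w : V} (h : G.Adj v w) :
    (nx σ v)^[deg G v] w = w := by
  have h1 := Function.iterate_minimalPeriod (f := σ) (x := (⟨(v, w), h⟩ : G.Dart))
  rw [minPeriod_deg hR h, sigma_iter hR h] at h1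
  simpa using congrArg (fun d : G.Dart => d.toProd.2) h1

theorem iter_inj [Finite V] (hR : IsRotationSystem G σ) {v w : V} (h : G.Adj v w) {i j : ℕ}
    (hi : i < deg G v) (hj : j < deg G v) (e : (nx σ v)^[i] w = (nx σ v)^[j] w) : i = j := by
  rw [← minPeriod_deg hR h] at hi hj
  refine Function.iterate_injOn_Iio_minimalPeriod (f := σ) (x := (⟨(v, w), h⟩ : G.Dart)) hi hj ?_
  simp only [sigma_iter hR h, e]

theorem iter_surj [Finite V] (hR : IsRotationSystem G σ) {v w y : V} (h : G.Adj v w)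
    (hy : G.Adj v y) : ∃ i < deg G v, (nx σ v)^[i] w = y := by
  classical
  have : Finite G.Dart := by
    have := Fintype.ofFinite V
    infer_instance
  obtain ⟨i, _, _, hi⟩ := (hR.orbit_eq ⟨(v, w), h⟩ ⟨(v, y), hy⟩ rfl).exists_pow_eq''
  rw [← Equiv.Perm.iterate_eq_pow] at hi
  have hpos : 0 < deg G v := by
    rw [deg]
    have : Nonempty (G.neighborSet v) := ⟨⟨w, h⟩⟩
    exact Nat.card_pos
  refine ⟨i % deg G v, Nat.mod_lt _ hpos, ?_⟩
  rw [← minPeriod_deg hR h]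
  have := Function.iterate_mod_minimalPeriod_eq (f := σ) (x := (⟨(v, w), h⟩ : G.Dart)) (n := i)
  rw [hi, sigma_iter hR h] at this
  simpa using congrArg (fun d : G.Dart => d.toProd.2) this

theorem nx_inj (hR : IsRotationSystem G σ) {v w y : V} (h : G.Adj v w)
    (hy : G.Adj v y) (e : nx σ v w = nx σ v y) : w = y := by
  obtain ⟨h1, e1⟩ := sigma_eq hR h
  obtain ⟨h2, e2⟩ := sigma_eq hR hy
  have : σ ⟨(v, w), h⟩ = σ ⟨(v, y), hy⟩ := by
    rw [e1, e2]; congr 2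
  simpa using congrArg (fun d : G.Dart => d.toProd.2) (σ.injective this)

/-- Faces are triangles. -/
theorem nx_face [Fintype V] (hT : IsPlaneTriangulation G σ) {v u w : V} (h : G.Adj v u)
    (e : nx σ v u = w) : G.Adj u w ∧ nx σ w v = u ∧ nx σ u w = v := by
  classical
  have hR := hT.rot
  have h3 := hT.face_size_eq ⟨(u, v), h.symm⟩
  rw [faceSize, card_sameCycle] at h3
  have h4 := Function.iterate_minimalPeriod (f := facePerm σ) (x := (⟨(u, v), h.symm⟩ : G.Dart))
  rw [h3] at h4
  have step : ∀ (a b : V) (hab : G.Adj a b), ∃ h', facePerm σ ⟨(a, b), hab⟩ =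
      ⟨(b, nx σ b a), h'⟩ := by
    intro a b hab
    obtain ⟨h', e⟩ := sigma_eq hR hab.symm
    exact ⟨h', e⟩
  subst e
  simp only [Function.iterate_succ_apply', Function.iterate_zero, id] at h4
  obtain ⟨h5, e5⟩ := step u v h.symm
  rw [e5] at h4
  obtain ⟨h6, e6⟩ := step _ _ h5
  rw [e6] at h4
  obtain ⟨h7, e7⟩ := step _ _ h6
  rw [e7] at h4
  have a1 := congrArg (fun d : G.Dart => d.toProd.1) h4
  have a2 := congrArg (fun d : G.Dart => d.toProd.2) h4
  simp only at a1 a2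
  rw [a1] at a2 h6
  exact ⟨h6.symm, a1, a2⟩

end basics




section homology

variable {G : SimpleGraph V} {σ : Equiv.Perm G.Dart}

theorem span_one_le {M : Type*} [AddCommGroup M] [Module (ZMod 2) M] (m : M) :
    Module.finrank (ZMod 2) (Submodule.span (ZMod 2) {m}) ≤ 1 :=
  (finrank_span_le_card ({m} : Set M)).trans (by simp)

/-- Every mod 2 cycle of a plane triangulation is the boundary of a set of faces. -/
theorem exists_side [Fintype V] [DecidableEq V] [Fintype G.Dart]
    (hT : IsPlaneTriangulation G σ) (c : G.Dart → ZMod 2)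
    (hsym : ∀ d : G.Dart, c d.symm = c d)
    (heven : ∀ v : V, ∑ d : G.Dart, (if d.toProd.1 = v then c d else 0) = 0) :
    ∃ A : G.Dart → ZMod 2, ∀ d : G.Dart, A (σ d) = A d.symm ∧ A d + A d.symm = c d := by
  classical
  have hR := hT.rot
  have two : ∀ a : ZMod 2, a + a = 0 := by decide
  have : Fintype G.edgeSet := Fintype.ofFinite _
  let Fc := Quotient (orbitSetoid (facePerm σ))
  have : Fintype Fc := Fintype.ofFinite _
  -- the quotient map
  let q : G.Dart → Fc := fun d => Quotient.mk (orbitSetoid (facePerm σ)) d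
  have hq : ∀ d : G.Dart, q (σ d) = q d.symm := by
    intro d
    refine Quotient.sound ?_
    change (facePerm σ).SameCycle (σ d) d.symm
    have : σ d = facePerm σ d.symm := by
      simp [facePerm, dartRev]
    rw [this]
    simpa using Equiv.Perm.SameCycle.refl _ _
  -- a section of the edge map
  have hout : ∀ e : G.edgeSet, ∃ d : G.Dart, d.edge = e.1 := by
    rintro ⟨e, he⟩
    induction e with
    | _ a b => exact ⟨⟨(a, b), he⟩, rfl⟩
  choose out hout using hout
  let ed : G.Dart → G.edgeSet := fun d => ⟨d.edge, d.edge_mem⟩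
  have hed : ∀ d : G.Dart, out (ed d) = d ∨ out (ed d) = d.symm := by
    intro d
    exact (SimpleGraph.dart_edge_eq_iff _ _).1 (hout (ed d))
  have hsy : ∀ d : G.Dart, ed d.symm = ed d := by
    intro d
    apply Subtype.ext
    exact SimpleGraph.Dart.edge_symm d
  -- boundary
  let bd : (Fc → ZMod 2) →ₗ[ZMod 2] (G.edgeSet → ZMod 2) :=
    { toFun := fun A e => A (q (out e)) + A (q (out e).symm)
      map_add' := by intro A B; ext e; simp; ring
      map_smul' := by intro a B; ext e; simp; ring }
  have hbd : ∀ A d, bd A (ed d) = A (q d) + A (q d.symm) := by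
    intro A d
    change A (q (out (ed d))) + A (q (out (ed d)).symm) = _
    rcases hed d with h | h
    · rw [h]
    · rw [h, SimpleGraph.Dart.symm_symm, add_comm]
  let dv : (G.edgeSet → ZMod 2) →ₗ[ZMod 2] (V → ZMod 2) :=
    { toFun := fun y v => ∑ d : G.Dart, (if d.toProd.1 = v then y (ed d) else 0)
      map_add' := by
        intro A B; ext v
        simp only [Pi.add_apply, ← Finset.sum_add_distrib]
        refine Finset.sum_congr rfl fun d _ => ?_
        split_ifs <;> simp
      map_smul' := by
        intro a B; ext v
        simp only [Pi.smul_apply, smul_eq_mul, RingHom.id_apply, Finset.mul_sum]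
        refine Finset.sum_congr rfl fun d _ => ?_
        split_ifs <;> simp }
  have hle : LinearMap.range bd ≤ LinearMap.ker dv := by
    rintro _ ⟨A, rfl⟩
    rw [LinearMap.mem_ker]
    ext v
    change ∑ d : G.Dart, (if d.toProd.1 = v then bd A (ed d) else 0) = 0
    have e1 : ∀ d : G.Dart, (if d.toProd.1 = v then bd A (ed d) else 0) =
        (if d.toProd.1 = v then A (q d) else 0) +
        (if (σ d).toProd.1 = v then A (q (σ d)) else 0) := by
      intro d
      rw [hR.fst_eq, hq, hbd]
      split_ifs <;> simp
    rw [Finset.sum_congr rfl fun d _ => e1 d, Finset.sum_add_distrib,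
      Equiv.sum_comp σ (fun d => if d.toProd.1 = v then A (q d) else 0)]
    exact two _
  -- kernel of the boundary
  have hker : Module.finrank (ZMod 2) (LinearMap.ker bd) ≤ 1 := by
    have : LinearMap.ker bd ≤ Submodule.span (ZMod 2) {(fun _ => 1 : Fc → ZMod 2)} := by
      intro A hA
      rw [LinearMap.mem_ker] at hA
      have h1 : ∀ d, A (q d) = A (q d.symm) := by
        intro d
        have := congrFun hA (ed d)
        rw [hbd] at this
        have h2 : ∀ a b : ZMod 2, a + b = 0 → a = b := by decide
        exact h2 _ _ this
      have h2 : ∀ d, A (q (σ d)) = A (q d) := by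
        intro d; rw [hq, ← h1]
      have h3 : ∀ d e : G.Dart, d.toProd.1 = e.toProd.1 → A (q d) = A (q e) := by
        intro d e hde
        obtain ⟨i, _, _, rfl⟩ := (hR.orbit_eq d e hde).exists_pow_eq''
        generalize i = j
        induction j with
        | zero => simp
        | succ j ih => rw [pow_succ', Equiv.Perm.mul_apply, h2, ih]
      have h4 : ∀ u v : V, G.Reachable u v → ∀ d e : G.Dart, d.toProd.1 = u → e.toProd.1 = v →
          A (q d) = A (q e) := by
        rintro u v ⟨p⟩
        induction p with
        | nil => intro d e hd he; exact h3 d e (hd.trans he.symm)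
        | @cons x y z hab p ih =>
          intro d e hd he
          rw [h3 d ⟨(x, y), hab⟩ hd, h1]
          exact ih _ _ rfl he
      rw [Submodule.mem_span_singleton]
      by_cases hne : Nonempty G.Dart
      · obtain ⟨d⟩ := hne
        refine ⟨A (q d), ?_⟩
        ext f
        induction f using Quotient.inductionOn with
        | _ e =>
          simp only [Pi.smul_apply, smul_eq_mul, mul_one]
          exact h4 _ _ (hT.connected.preconnected _ _) d e rfl rfl
      · refine ⟨0, ?_⟩
        ext f
        induction f using Quotient.inductionOn with
        | _ e => exact absurd ⟨e⟩ hne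
    exact (Submodule.finrank_mono this).trans (span_one_le _)
  -- range of the divergence
  have hrange : Fintype.card V ≤ Module.finrank (ZMod 2) (LinearMap.range dv) + 1 := by
    obtain ⟨v0⟩ := hT.connected.nonempty
    have hadj : ∀ a b : V, G.Adj a b →
        (Pi.single a 1 + Pi.single b 1 : V → ZMod 2) ∈ LinearMap.range dv := by
      intro a b hab
      let d0 : G.Dart := ⟨(a, b), hab⟩
      refine ⟨Pi.single (ed d0) 1, ?_⟩
      ext v
      change ∑ d : G.Dart, (if d.toProd.1 = v then
        (Pi.single (ed d0) 1 : G.edgeSet → ZMod 2) (ed d) else 0) = _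
      have hne : d0 ≠ d0.symm := fun h => hab.ne (congrArg (fun d : G.Dart => d.toProd.1) h)
      have e1 : ∀ d : G.Dart, (if d.toProd.1 = v then
          (Pi.single (ed d0) 1 : G.edgeSet → ZMod 2) (ed d) else 0) =
          (if d = d0 then (if a = v then 1 else 0) else 0) +
          (if d = d0.symm then (if b = v then 1 else 0) else 0) := by
        intro d
        by_cases h1 : d = d0
        · subst h1
          simp [hab.ne, hab.ne', d0]
        · by_cases h2 : d = d0.symm
          · subst h2
            rw [hsy]
            simp [hab.ne, hab.ne', d0]
          · have : ed d ≠ ed d0 := by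
              intro h
              rcases (SimpleGraph.dart_edge_eq_iff _ _).1 (congrArg Subtype.val h) with h | h
              · exact h1 h
              · exact h2 h
            simp [h1, h2, this]
      rw [Finset.sum_congr rfl fun d _ => e1 d, Finset.sum_add_distrib]
      simp [Pi.single_apply, eq_comm]
    have hreach : ∀ a b : V, G.Reachable a b →
        (Pi.single a 1 + Pi.single b 1 : V → ZMod 2) ∈ LinearMap.range dv := by
      rintro a b ⟨p⟩
      induction p with
      | @nil x =>
        have : (Pi.single x 1 + Pi.single x 1 : V → ZMod 2) = 0 := by
          ext w; exact two _
        rw [this]; exact Submodule.zero_mem _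
      | @cons x y z hxy p ih =>
        have h1 := Submodule.add_mem _ (hadj _ _ hxy) ih
        have : (Pi.single x 1 + Pi.single y 1 + (Pi.single y 1 + Pi.single z 1) : V → ZMod 2) =
            Pi.single x 1 + Pi.single z 1 := by
          ext w
          simp only [Pi.add_apply]
          have := two ((Pi.single y 1 : V → ZMod 2) w)
          linear_combination this
        rwa [this] at h1
    have htop : LinearMap.range dv ⊔ Submodule.span (ZMod 2) {(Pi.single v0 1 : V → ZMod 2)} = ⊤ := by
      rw [eq_top_iff]
      intro y _
      rw [← Finset.univ_sum_single y]
      refine Submodule.sum_mem _ fun a _ => ?_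
      have : (Pi.single a (y a) : V → ZMod 2) =
          y a • (Pi.single a 1 + Pi.single v0 1) + y a • Pi.single v0 1 := by
        ext w
        simp only [Pi.add_apply, Pi.smul_apply, smul_eq_mul]
        have := two (y a * (Pi.single v0 1 : V → ZMod 2) w)
        have h2 : (Pi.single a (y a) : V → ZMod 2) w = y a * (Pi.single a 1 : V → ZMod 2) w := by
          simp [Pi.single_apply]
        rw [h2]
        linear_combination -this
      rw [this]
      refine Submodule.add_mem _ (Submodule.mem_sup_left ?_) (Submodule.mem_sup_right ?_)
      · exact Submodule.smul_mem _ _ (hreach _ _ (hT.connected.preconnected _ _))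
      · exact Submodule.smul_mem _ _ (Submodule.mem_span_singleton_self _)
    have h1 := Submodule.finrank_add_le_finrank_add_finrank (LinearMap.range dv)
      (Submodule.span (ZMod 2) {(Pi.single v0 1 : V → ZMod 2)})
    rw [htop, finrank_top, Module.finrank_fintype_fun_eq_card] at h1
    have h2 := span_one_le (Pi.single v0 1 : V → ZMod 2)
    omega
  have r1 := LinearMap.finrank_range_add_finrank_ker bd
  have r2 := LinearMap.finrank_range_add_finrank_ker dv
  rw [Module.finrank_fintype_fun_eq_card] at r1 r2
  have hE := hT.euler
  rw [numFaces, Nat.card_eq_fintype_card, Nat.card_eq_fintype_card] at hE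
  have heq : LinearMap.range bd = LinearMap.ker dv := by
    apply Submodule.eq_of_le_of_finrank_le hle
    have : Fintype.card Fc = Fintype.card (Quotient (orbitSetoid (facePerm σ))) := by
      convert rfl
    omega
  -- conclude
  let y : G.edgeSet → ZMod 2 := fun e => c (out e)
  have hy : ∀ d, y (ed d) = c d := by
    intro d
    change c (out (ed d)) = _
    rcases hed d with h | h
    · rw [h]
    · rw [h, hsym]
  have hyk : y ∈ LinearMap.ker dv := by
    rw [LinearMap.mem_ker]
    ext v
    change ∑ d : G.Dart, (if d.toProd.1 = v then y (ed d) else 0) = 0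
    simp only [hy]
    exact heven v
  rw [← heq] at hyk
  obtain ⟨A, hA⟩ := hyk
  refine ⟨fun d => A (q d), fun d => ⟨congrArg A (hq d), ?_⟩⟩
  rw [← hy, ← hbd, hA]

end homology




section crossing

variable {G : SimpleGraph V} {σ : Equiv.Perm G.Dart}

/-- Adjacency inside a set. -/
def adjIn (G : SimpleGraph V) (P : Set V) (y z : V) : Prop := G.Adj y z ∧ y ∈ P ∧ z ∈ P

theorem edge_chain [DecidableEq V] [Fintype G.Dart] {a b : V} (hab : G.Adj a b) :
    ∃ z : G.Dart → ZMod 2, (∀ d, z d.symm = z d) ∧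
      (∀ d, z d ≠ 0 → (d.toProd = (a, b) ∨ d.toProd = (b, a))) ∧
      (∀ d, (d.toProd = (a, b) ∨ d.toProd = (b, a)) → z d = 1) ∧
      ∀ w, ∑ d : G.Dart, (if d.toProd.1 = w then z d else 0) =
        (if a = w then 1 else 0) + (if b = w then 1 else 0) := by
  classical
  let d0 : G.Dart := ⟨(a, b), hab⟩
  have hne : d0 ≠ d0.symm := fun h => hab.ne (congrArg (fun d : G.Dart => d.toProd.1) h)
  have e1 : ∀ d : G.Dart, d.toProd = (a, b) ↔ d = d0 := fun d =>
    ⟨fun h => SimpleGraph.Dart.ext _ _ h, fun h => by rw [h]⟩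
  have e2 : ∀ d : G.Dart, d.toProd = (b, a) ↔ d = d0.symm := fun d =>
    ⟨fun h => SimpleGraph.Dart.ext _ _ h, fun h => by rw [h]; rfl⟩
  have e3 : ∀ d : G.Dart, d.symm = d0 ↔ d = d0.symm := fun d =>
    ⟨fun h => by rw [← h, SimpleGraph.Dart.symm_symm], fun h => by rw [h, SimpleGraph.Dart.symm_symm]⟩
  have e4 : ∀ d : G.Dart, d.symm = d0.symm ↔ d = d0 := fun d =>
    ⟨fun h => by rw [← d.symm_symm, h, SimpleGraph.Dart.symm_symm], fun h => by rw [h]⟩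
  simp only [e1, e2]
  refine ⟨fun d => (if d = d0 then 1 else 0) + (if d = d0.symm then 1 else 0), ?_, ?_, ?_, ?_⟩
  · intro d
    simp only [e3, e4]
    rw [add_comm]
  · intro d hd
    by_contra hcon
    push Not at hcon
    simp [hcon.1, hcon.2] at hd
  · rintro d (h | h)
    · simp [h, hne]
    · simp [h, hne.symm]
  · intro w
    have : ∀ d : G.Dart, (if d.toProd.1 = w then
        ((if d = d0 then 1 else 0) + (if d = d0.symm then 1 else 0) : ZMod 2) else 0) =
        (if d = d0 then (if a = w then 1 else 0) else 0) +
        (if d = d0.symm then (if b = w then 1 else 0) else 0) := by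
      intro d
      by_cases h1 : d = d0
      · subst h1; simp [hab.ne, hab.ne', d0]
      · by_cases h2 : d = d0.symm
        · subst h2; simp [hab.ne, hab.ne', d0]
        · simp [h1, h2]
    rw [Finset.sum_congr rfl fun d _ => this d, Finset.sum_add_distrib]
    simp

theorem path_chain [DecidableEq V] [Fintype G.Dart] {P : Set V} {a b : V}
    (h : Relation.ReflTransGen (adjIn G P) a b) :
    ∃ z : G.Dart → ZMod 2, (∀ d, z d.symm = z d) ∧
      (∀ d, z d ≠ 0 → d.toProd.1 ∈ P) ∧
      ∀ w, ∑ d : G.Dart, (if d.toProd.1 = w then z d else 0) =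
        (if a = w then 1 else 0) + (if b = w then 1 else 0) := by
  have two : ∀ a : ZMod 2, a + a = 0 := by decide
  induction h with
  | refl => exact ⟨0, by simp, by simp, by simp [two]⟩
  | @tail y w _ hyw ih =>
    obtain ⟨z, z1, z2, z3⟩ := ih
    obtain ⟨t, t1, t2, _, t3⟩ := edge_chain hyw.1
    refine ⟨z + t, ?_, ?_, ?_⟩
    · intro d; simp [z1, t1]
    · intro d hd
      by_cases hz : z d = 0
      · have : t d ≠ 0 := by intro ht; simp [hz, ht] at hd
        rcases t2 d this with h | h
        · rw [h]; exact hyw.2.1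
        · rw [h]; exact hyw.2.2
      · exact z2 d hz
    · intro u
      have : ∀ d : G.Dart, (if d.toProd.1 = u then (z + t) d else 0) =
        (if d.toProd.1 = u then z d else 0) + (if d.toProd.1 = u then t d else 0) := by
        intro d; split_ifs <;> simp
      rw [Finset.sum_congr rfl fun d _ => this d, Finset.sum_add_distrib, z3, t3]
      have := two (if y = u then 1 else 0)
      linear_combination this

/-- Two disjoint paths between alternating neighbors of a vertex cannot exist. -/
theorem crossing [Fintype V] (hT : IsPlaneTriangulation G σ) {v a : V} (h : G.Adj v a)
    {j k l : ℕ} (hj : 0 < j) (hjk : j < k) (hkl : k < l) (hl : l < deg G v)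
    (P Q : Set V) (hPQ : ∀ y ∈ P, y ∉ Q) (hvP : v ∉ P) (hvQ : v ∉ Q)
    (hP : Relation.ReflTransGen (adjIn G P) a ((nx σ v)^[k] a))
    (hQ : Relation.ReflTransGen (adjIn G Q) ((nx σ v)^[j] a) ((nx σ v)^[l] a)) : False := by
  classical
  have hR := hT.rot
  have two : ∀ a : ZMod 2, a + a = 0 := by decide
  set N : ℕ → V := fun i => (nx σ v)^[i] a with hN
  have hadj : ∀ i, G.Adj v (N i) := adj_iter hR h
  have hinj : ∀ i i', i < deg G v → i' < deg G v → N i = N i' → i = i' :=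
    fun i i' hi hi' e => iter_inj hR h hi hi' e
  change Relation.ReflTransGen (adjIn G P) (N 0) (N k) at hP
  change Relation.ReflTransGen (adjIn G Q) (N j) (N l) at hQ
  have hjQ : N j ∈ Q := by
    rcases Relation.ReflTransGen.cases_head hQ with e | ⟨c, hc, _⟩
    · have := hinj j l (by omega) (by omega) e
      omega
    · exact hc.2.1
  have hlQ : N l ∈ Q := by
    rcases Relation.ReflTransGen.cases_tail hQ with e | ⟨c, _, hc⟩
    · have := hinj j l (by omega) (by omega) e.symm
      omega
    · exact hc.2.2
  obtain ⟨z, z1, z2, z3⟩ := path_chain hP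
  obtain ⟨t, t1, t2, t3, t4⟩ := edge_chain (hadj 0)
  obtain ⟨s, s1, s2, s3, s4⟩ := edge_chain (hadj k)
  have hP0 : N 0 ∈ P := by
    rcases Relation.ReflTransGen.cases_head hP with e | ⟨c, hc, _⟩
    · have := hinj 0 k (by omega) (by omega) e
      omega
    · exact hc.2.1
  have hPk : N k ∈ P := by
    rcases Relation.ReflTransGen.cases_tail hP with e | ⟨c, _, hc⟩
    · have := hinj 0 k (by omega) (by omega) e.symm
      omega
    · exact hc.2.2
  let c : G.Dart → ZMod 2 := fun d => z d + t d + s d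
  obtain ⟨A, hA⟩ := exists_side hT c (by intro d; simp [c, z1, t1, s1]) (by
    intro u
    have : ∀ d : G.Dart, (if d.toProd.1 = u then c d else 0) =
        (if d.toProd.1 = u then z d else 0) + (if d.toProd.1 = u then t d else 0) +
        (if d.toProd.1 = u then s d else 0) := by
      intro d; split_ifs <;> simp [c]
    rw [Finset.sum_congr rfl fun d _ => this d, Finset.sum_add_distrib, Finset.sum_add_distrib,
      z3, t4, s4]
    have := two (if v = u then 1 else 0)
    have h2 := two (if N 0 = u then 1 else 0)
    have h3 := two (if N k = u then 1 else 0)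
    linear_combination this + h2 + h3)
  have hstep : ∀ d, A (σ d) = A d + c d := by
    intro d
    rw [(hA d).1, ← (hA d).2]
    linear_combination -two (A d)
  -- darts at vertices of Q
  have hcQ : ∀ d : G.Dart, d.toProd.1 ∈ Q → c d = 0 := by
    intro d hd
    have hzd : z d = 0 := by
      by_contra hz; exact hPQ _ (z2 d hz) hd
    have htd : t d = 0 := by
      by_contra hz
      rcases t2 d hz with e | e
      · rw [e] at hd; exact hvQ hd
      · rw [e] at hd; exact hPQ _ hP0 hd
    have hsd : s d = 0 := by
      by_contra hz
      rcases s2 d hz with e | e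
      · rw [e] at hd; exact hvQ hd
      · rw [e] at hd; exact hPQ _ hPk hd
    simp [c, hzd, htd, hsd]
  have hsame : ∀ d e : G.Dart, d.toProd.1 ∈ Q → d.toProd.1 = e.toProd.1 → A d = A e := by
    intro d e hd hde
    obtain ⟨i, _, _, rfl⟩ := (hR.orbit_eq d e hde).exists_pow_eq''
    clear hde
    generalize i = m
    have hf : ((σ ^ m) d).toProd.1 = d.toProd.1 ∧ A d = A ((σ ^ m) d) := by
      induction m with
      | zero => simp
      | succ m ih =>
        rw [pow_succ', Equiv.Perm.mul_apply, hR.fst_eq, hstep, hcQ _ (by rw [ih.1]; exact hd)]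
        simpa using ih
    exact hf.2
  have hsymm : ∀ d : G.Dart, d.toProd.1 ∈ Q → A d = A d.symm := by
    intro d hd
    have := (hA d).2
    rw [hcQ d hd] at this
    linear_combination this - two (A d.symm)
  have hconn : ∀ y, Relation.ReflTransGen (adjIn G Q) (N j) y → ∀ d e : G.Dart,
      d.toProd.1 = N j → e.toProd.1 = y → A d = A e := by
    intro y hy
    induction hy with
    | refl => intro d e hd he; exact hsame d e (hd ▸ hjQ) (hd.trans he.symm)
    | @tail y w _ hyw ih =>
      intro d e hd he
      rw [ih d ⟨(y, w), hyw.1⟩ hd rfl, hsymm _ hyw.2.1]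
      exact hsame _ _ hyw.2.2 he.symm
  have hfin : A ⟨(v, N j), hadj j⟩ = A ⟨(v, N l), hadj l⟩ := by
    have e1 := hsymm ⟨(N j, v), (hadj j).symm⟩ hjQ
    have e2 := hsymm ⟨(N l, v), (hadj l).symm⟩ hlQ
    have e3 := hconn _ hQ ⟨(N j, v), (hadj j).symm⟩ ⟨(N l, v), (hadj l).symm⟩ rfl rfl
    exact e1.symm.trans (e3.trans e2)
  -- turning around v
  have hcv : ∀ i, 0 < i → i < deg G v →
      c ⟨(v, N i), hadj i⟩ = if i = k then 1 else 0 := by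
    intro i hi hi'
    have hzd : z ⟨(v, N i), hadj i⟩ = 0 := by
      by_contra hz; exact hvP (z2 _ hz)
    have htd : t ⟨(v, N i), hadj i⟩ = 0 := by
      by_contra hz
      rcases t2 _ hz with e | e
      · have := hinj i 0 hi' (by omega) (congrArg Prod.snd e)
        omega
      · exact (hadj 0).ne (congrArg Prod.fst e)
    have hsd : s ⟨(v, N i), hadj i⟩ = if i = k then 1 else 0 := by
      split_ifs with hik
      · subst hik; exact s3 _ (Or.inl rfl)
      · by_contra hz
        rcases s2 _ hz with e | e
        · exact hik (hinj i k hi' (by omega) (congrArg Prod.snd e))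
        · exact (hadj k).ne (congrArg Prod.fst e)
    simp [c, hzd, htd, hsd]
  have hnext : ∀ i, A ⟨(v, N (i + 1)), hadj (i + 1)⟩ =
      A ⟨(v, N i), hadj i⟩ + c ⟨(v, N i), hadj i⟩ := by
    intro i
    rw [← hstep]
    have e1 := sigma_iter hR h i
    have e2 := sigma_iter hR h (i + 1)
    rw [Function.iterate_succ_apply', e1] at e2
    exact congrArg A e2.symm
  have hwalk : ∀ m, j + m ≤ l → A ⟨(v, N (j + m)), hadj (j + m)⟩ =
      A ⟨(v, N j), hadj j⟩ + (if k < j + m then 1 else 0) := by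
    intro m
    induction m with
    | zero => intro _; simp; omega
    | succ m ih =>
      intro hm
      have e1 := hnext (j + m)
      rw [hcv (j + m) (by omega) (by omega), ih (by omega)] at e1
      refine e1.trans ?_
      rcases lt_trichotomy (j + m) k with h1 | h1 | h1
      · rw [if_neg (by omega), if_neg (by omega), if_neg (by omega)]; simp
      · rw [if_neg (by omega), if_pos (by omega), if_pos (by omega)]; simp
      · rw [if_pos (by omega), if_neg (by omega), if_pos (by omega)]; simp
  have hlast := hwalk (l - j) (by omega)
  rw [if_pos (by omega)] at hlast
  have hl' : j + (l - j) = l := by omega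
  simp only [hl'] at hlast
  rw [← hfin] at hlast
  have : (1 : ZMod 2) = 0 := by linear_combination -hlast
  exact absurd this (by decide)

end crossing




section kempe

variable {G : SimpleGraph V} {σ : Equiv.Perm G.Dart}

/-- `f` is a proper coloring on `D` whose class of color `k` is `K`. -/
structure ColOn (G : SimpleGraph V) (k : Fin 5) (D K : Set V) (f : V → Fin 5) : Prop where
  proper : ∀ u ∈ D, ∀ w ∈ D, G.Adj u w → f u ≠ f w
  cls : ∀ w ∈ D, (f w = k ↔ w ∈ K)

/-- `D` can be properly colored with `K` being the class of color `k`. -/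
def Good (G : SimpleGraph V) (k : Fin 5) (D K : Set V) : Prop :=
  K ⊆ D ∧ ∃ f : V → Fin 5, ColOn G k D K f

/-- The set of vertices of `D` with color `i` or `j`. -/
def twoCol (D : Set V) (f : V → Fin 5) (i j : Fin 5) : Set V := {w | w ∈ D ∧ (f w = i ∨ f w = j)}

theorem swap_free {k : Fin 5} {D K : Set V} {f : V → Fin 5} (hf : ColOn G k D K f) {s t : V}
    (hs : s ∈ D) (hst : f s ≠ f t) (hsk : f s ≠ k) (htk : f t ≠ k)
    (hC : ¬ Relation.ReflTransGen (adjIn G (twoCol D f (f s) (f t))) s t) :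
    ∃ f', ColOn G k D K f' ∧ f' s = f t ∧ f' t = f t ∧
      ∀ w, f w ≠ f s → f w ≠ f t → f' w = f w := by
  classical
  let C : V → Prop := Relation.ReflTransGen (adjIn G (twoCol D f (f s) (f t))) s
  have hCmem : ∀ w, C w → w ∈ twoCol D f (f s) (f t) := by
    intro w hw
    rcases Relation.ReflTransGen.cases_tail hw with e | ⟨c, _, hc⟩
    · rw [e]; exact ⟨hs, Or.inl rfl⟩
    · exact hc.2.2
  let f' : V → Fin 5 := fun w => if C w then Equiv.swap (f s) (f t) (f w) else f w
  have hin : ∀ w, C w → f' w = Equiv.swap (f s) (f t) (f w) := fun w hw => if_pos hw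
  have hout : ∀ w, ¬ C w → f' w = f w := fun w hw => if_neg hw
  have hmix : ∀ u ∈ D, ∀ w ∈ D, G.Adj u w → C u → ¬ C w → f' u ≠ f' w := by
    intro u hu w hw huw hCu hCw
    have h1 := hCmem u hCu
    have h2 : f w ≠ f s ∧ f w ≠ f t := by
      by_contra hcon
      have : f w = f s ∨ f w = f t := by tauto
      exact hCw (Relation.ReflTransGen.tail hCu ⟨huw, h1, hw, this⟩)
    rw [hin u hCu, hout w hCw]
    rcases h1.2 with e | e
    · rw [e, Equiv.swap_apply_left]; exact h2.2.symm
    · rw [e, Equiv.swap_apply_right]; exact h2.1.symm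
  refine ⟨f', ⟨?_, ?_⟩, ?_, ?_, ?_⟩
  · intro u hu w hw huw
    by_cases h1 : C u <;> by_cases h2 : C w
    · rw [hin u h1, hin w h2]
      exact fun e => hf.proper u hu w hw huw ((Equiv.swap (f s) (f t)).injective e)
    · exact hmix u hu w hw huw h1 h2
    · exact (hmix w hw u hu huw.symm h2 h1).symm
    · rw [hout u h1, hout w h2]
      exact hf.proper u hu w hw huw
  · intro w hw
    rw [← hf.cls w hw]
    by_cases h1 : C w
    · rw [hin w h1]
      rcases (hCmem w h1).2 with e | e
      · rw [e, Equiv.swap_apply_left]; tauto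
      · rw [e, Equiv.swap_apply_right]; tauto
    · rw [hout w h1]
  · rw [hin s Relation.ReflTransGen.refl, Equiv.swap_apply_left]
  · exact hout t hC
  · intro w h1 h2
    by_cases h3 : C w
    · rcases (hCmem w h3).2 with e | e
      · exact absurd e h1
      · exact absurd e h2
    · exact hout w h3

theorem extend_free {k : Fin 5} {D K : Set V} {f : V → Fin 5} (hf : ColOn G k D K f)
    (hKD : K ⊆ D) {v : V} (hv : v ∉ D) {i : Fin 5} (hik : i ≠ k)
    (hi : ∀ w ∈ D, G.Adj v w → f w ≠ i) : Good G k (insert v D) K := by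
  classical
  refine ⟨hKD.trans (Set.subset_insert _ _), Function.update f v i, ⟨?_, ?_⟩⟩
  · have hne : ∀ w ∈ D, w ≠ v := fun w hw e => hv (e ▸ hw)
    rintro u (rfl | hu) w (rfl | hw) huw
    · exact absurd huw (G.loopless.irrefl _)
    · rw [Function.update_self, Function.update_of_ne (hne w hw)]
      exact (hi w hw huw).symm
    · rw [Function.update_self, Function.update_of_ne (hne u hu)]
      exact hi u hu huw.symm
    · rw [Function.update_of_ne (hne w hw), Function.update_of_ne (hne u hu)]
      exact hf.proper u hu w hw huw
  · rintro w (rfl | hw)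
    · rw [Function.update_self]
      exact ⟨fun e => absurd e hik, fun e => absurd (hKD e) hv⟩
    · have hne : w ≠ v := fun e => hv (e ▸ hw)
      rw [Function.update_of_ne hne]
      exact hf.cls w hw

theorem extend_k {k : Fin 5} {D K : Set V} (hg : Good G k D K) {v : V} (hv : v ∉ D)
    (hi : ∀ w ∈ K, ¬ G.Adj v w) : Good G k (insert v D) (insert v K) := by
  classical
  obtain ⟨hKD, f, hf⟩ := hg
  refine ⟨Set.insert_subset_insert hKD, Function.update f v k, ⟨?_, ?_⟩⟩
  · have hne : ∀ w ∈ D, w ≠ v := fun w hw e => hv (e ▸ hw)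
    have hi' : ∀ w ∈ D, G.Adj v w → f w ≠ k := fun w hw h e => hi w ((hf.cls w hw).1 e) h
    rintro u (rfl | hu) w (rfl | hw) huw
    · exact absurd huw (G.loopless.irrefl _)
    · rw [Function.update_self, Function.update_of_ne (hne w hw)]
      exact (hi' w hw huw).symm
    · rw [Function.update_self, Function.update_of_ne (hne u hu)]
      exact hi' u hu huw.symm
    · rw [Function.update_of_ne (hne w hw), Function.update_of_ne (hne u hu)]
      exact hf.proper u hu w hw huw
  · rintro w (rfl | hw)
    · simp
    · have hne : w ≠ v := fun e => hv (e ▸ hw)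
      rw [Function.update_of_ne hne, hf.cls w hw]
      simp [hne]

theorem kempe4 [Fintype V] (hT : IsPlaneTriangulation G σ) {k : Fin 5} {D K : Set V}
    {f : V → Fin 5} (hf : ColOn G k D K f) (hKD : K ⊆ D) {v : V} (hv : v ∉ D)
    {w1 w2 w3 w4 : V} (h1 : G.Adj v w1) {j l m : ℕ} (hj : 0 < j) (hjl : j < l) (hlm : l < m)
    (hm : m < deg G v) (e2 : (nx σ v)^[j] w1 = w2) (e3 : (nx σ v)^[l] w1 = w3)
    (e4 : (nx σ v)^[m] w1 = w4) (hw1 : w1 ∈ D) (hw2 : w2 ∈ D)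
    (n1 : f w1 ≠ k) (n2 : f w2 ≠ k) (n3 : f w3 ≠ k) (n4 : f w4 ≠ k)
    (h12 : f w1 ≠ f w2) (h13 : f w1 ≠ f w3) (h14 : f w1 ≠ f w4) (h23 : f w2 ≠ f w3)
    (h24 : f w2 ≠ f w4) (h34 : f w3 ≠ f w4)
    (hall : ∀ y ∈ D, G.Adj v y → y ∉ K → y = w1 ∨ y = w2 ∨ y = w3 ∨ y = w4) :
    Good G k (insert v D) K := by
  by_cases hC : Relation.ReflTransGen (adjIn G (twoCol D f (f w1) (f w3))) w1 w3
  · by_cases hC2 : Relation.ReflTransGen (adjIn G (twoCol D f (f w2) (f w4))) w2 w4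
    · exfalso
      subst e2 e3 e4
      refine crossing hT h1 hj hjl hlm hm _ _ ?_ ?_ ?_ hC hC2
      · rintro y ⟨_, ha | ha⟩ ⟨_, hb | hb⟩ <;> rw [ha] at hb <;> tauto
      · exact fun h => hv h.1
      · exact fun h => hv h.1
    · obtain ⟨f', hf', a1, a2, a3⟩ := swap_free hf hw2 h24 n2 n4 hC2
      refine extend_free hf' hKD hv n2 ?_
      intro y hy hvy
      by_cases hyK : y ∈ K
      · rw [(hf'.cls y hy).2 hyK]; exact n2.symm
      · rcases hall y hy hvy hyK with rfl | rfl | rfl | rfl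
        · rw [a3 _ h12 h14]; exact h12
        · rw [a1]; exact h24.symm
        · rw [a3 _ h23.symm h34]; exact h23.symm
        · rw [a2]; exact h24.symm
  · obtain ⟨f', hf', a1, a2, a3⟩ := swap_free hf hw1 h13 n1 n3 hC
    refine extend_free hf' hKD hv n1 ?_
    intro y hy hvy
    by_cases hyK : y ∈ K
    · rw [(hf'.cls y hy).2 hyK]; exact n1.symm
    · rcases hall y hy hvy hyK with rfl | rfl | rfl | rfl
      · rw [a1]; exact h13.symm
      · rw [a3 _ h12.symm h23]; exact h12.symm
      · rw [a2]; exact h13.symm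
      · rw [a3 _ h14.symm h34.symm]; exact h14.symm

theorem four_colors : ∀ k : Fin 5, ∃ a b c d : Fin 5, a ≠ k ∧ b ≠ k ∧ c ≠ k ∧ d ≠ k ∧ a ≠ b ∧
    a ≠ c ∧ a ≠ d ∧ b ≠ c ∧ b ≠ d ∧ c ≠ d ∧ ∀ x, x = k ∨ x = a ∨ x = b ∨ x = c ∨ x = d := by
  decide

/-- Restoring a vertex with at most four already colored neighbors outside the class `K`. -/
theorem restore4 [Fintype V] (hT : IsPlaneTriangulation G σ) {k : Fin 5} {D K : Set V}
    (hg : Good G k D K) {v : V} (hv : v ∉ D)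
    (hcard : Set.ncard {w | w ∈ D ∧ G.Adj v w ∧ w ∉ K} ≤ 4) : Good G k (insert v D) K := by
  classical
  obtain ⟨hKD, f, hf⟩ := hg
  by_cases hfree : ∃ i, i ≠ k ∧ ∀ w ∈ D, G.Adj v w → f w ≠ i
  · obtain ⟨i, hik, hi⟩ := hfree
    exact extend_free hf hKD hv hik hi
  push Not at hfree
  obtain ⟨a, b, c, d, ka, kb, kc, kd, ab, ac, ad, bc, bd, cd, -⟩ := four_colors k
  obtain ⟨w1, d1, j1, rfl⟩ := hfree a ka
  obtain ⟨w2, d2, j2, rfl⟩ := hfree b kb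
  obtain ⟨w3, d3, j3, rfl⟩ := hfree c kc
  obtain ⟨w4, d4, j4, rfl⟩ := hfree d kd
  have hall : ∀ y ∈ D, G.Adj v y → y ∉ K → y = w1 ∨ y = w2 ∨ y = w3 ∨ y = w4 := by
    have hsub : ({w1, w2, w3, w4} : Set V) ⊆ {w | w ∈ D ∧ G.Adj v w ∧ w ∉ K} := by
      rintro y (rfl | rfl | rfl | rfl)
      · exact ⟨d1, j1, fun h => ka ((hf.cls _ d1).2 h)⟩
      · exact ⟨d2, j2, fun h => kb ((hf.cls _ d2).2 h)⟩
      · exact ⟨d3, j3, fun h => kc ((hf.cls _ d3).2 h)⟩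
      · exact ⟨d4, j4, fun h => kd ((hf.cls _ d4).2 h)⟩
    have h4 : Set.ncard ({w1, w2, w3, w4} : Set V) = 4 := by
      have e : ({w1, w2, w3, w4} : Set V) = (({w1, w2, w3, w4} : Finset V) : Set V) := by simp
      rw [e, Set.ncard_coe_finset, Finset.card_insert_of_notMem, Finset.card_insert_of_notMem,
        Finset.card_pair]
      · rintro rfl; exact cd rfl
      · simp only [Finset.mem_insert, Finset.mem_singleton, not_or]
        exact ⟨by rintro rfl; exact bc rfl, by rintro rfl; exact bd rfl⟩
      · simp only [Finset.mem_insert, Finset.mem_singleton, not_or]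
        exact ⟨by rintro rfl; exact ab rfl, by rintro rfl; exact ac rfl,
          by rintro rfl; exact ad rfl⟩
    have heq := Set.eq_of_subset_of_ncard_le hsub (by omega) (Set.toFinite _)
    intro y hy hvy hyK
    have : y ∈ ({w1, w2, w3, w4} : Set V) := by rw [heq]; exact ⟨hy, hvy, hyK⟩
    simpa using this
  obtain ⟨p2, q2, e2⟩ := iter_surj hT.rot j1 j2
  obtain ⟨p3, q3, e3⟩ := iter_surj hT.rot j1 j3
  obtain ⟨p4, q4, e4⟩ := iter_surj hT.rot j1 j4
  have z2 : 0 < p2 := by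
    rcases Nat.eq_zero_or_pos p2 with rfl | h
    · exact absurd (congrArg f e2) ab
    · exact h
  have z3 : 0 < p3 := by
    rcases Nat.eq_zero_or_pos p3 with rfl | h
    · exact absurd (congrArg f e3) ac
    · exact h
  have z4 : 0 < p4 := by
    rcases Nat.eq_zero_or_pos p4 with rfl | h
    · exact absurd (congrArg f e4) ad
    · exact h
  have z23 : p2 ≠ p3 := by rintro rfl; exact bc (by rw [← e2, ← e3])
  have z24 : p2 ≠ p4 := by rintro rfl; exact bd (by rw [← e2, ← e4])
  have z34 : p3 ≠ p4 := by rintro rfl; exact cd (by rw [← e3, ← e4])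
  rcases lt_or_gt_of_ne z23 with y23 | y23 <;> rcases lt_or_gt_of_ne z24 with y24 | y24 <;>
    rcases lt_or_gt_of_ne z34 with y34 | y34
  · exact kempe4 hT hf hKD hv j1 z2 y23 y34 q4 e2 e3 e4 d1 d2 ka kb kc kd ab ac ad bc bd cd hall
  · exact kempe4 hT hf hKD hv j1 z2 y24 y34 q3 e2 e4 e3 d1 d2 ka kb kd kc ab ad ac bd bc cd.symm
      (by intro y h1 h2 h3; have := hall y h1 h2 h3; tauto)
  · omega
  · exact kempe4 hT hf hKD hv j1 z4 y24 y23 q3 e4 e2 e3 d1 d4 ka kd kb kc ad ab ac bd.symm cd.symm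
      bc (by intro y h1 h2 h3; have := hall y h1 h2 h3; tauto)
  · exact kempe4 hT hf hKD hv j1 z3 y23 y24 q4 e3 e2 e4 d1 d3 ka kc kb kd ac ab ad bc.symm cd
      bd (by intro y h1 h2 h3; have := hall y h1 h2 h3; tauto)
  · omega
  · exact kempe4 hT hf hKD hv j1 z3 y34 y24 q2 e3 e4 e2 d1 d3 ka kc kd kb ac ad ab cd bc.symm
      bd.symm (by intro y h1 h2 h3; have := hall y h1 h2 h3; tauto)
  · exact kempe4 hT hf hKD hv j1 z4 y34 y23 q2 e4 e3 e2 d1 d4 ka kd kc kb ad ac ab cd.symm bd.symm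
      bc.symm (by intro y h1 h2 h3; have := hall y h1 h2 h3; tauto)

/-- Restoring a vertex with at most four already colored neighbors. -/
theorem restore4' [Fintype V] (hT : IsPlaneTriangulation G σ) {k : Fin 5} {D K : Set V}
    (hg : Good G k D K) {v : V} (hv : v ∉ D)
    (hcard : Set.ncard {w | w ∈ D ∧ G.Adj v w} ≤ 4) : Good G k (insert v D) K := by
  refine restore4 hT hg hv (le_trans (Set.ncard_le_ncard ?_ (Set.toFinite _)) hcard)
  rintro w ⟨a, b, c⟩
  exact ⟨a, b⟩

/-- Restoring a vertex with at most five already colored neighbors, one in the class `K`. -/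
theorem restore5 [Fintype V] (hT : IsPlaneTriangulation G σ) {k : Fin 5} {D K : Set V}
    (hg : Good G k D K) {v w : V} (hv : v ∉ D)
    (hcard : Set.ncard {w | w ∈ D ∧ G.Adj v w} ≤ 5) (hw : w ∈ K) (hvw : G.Adj v w) :
    Good G k (insert v D) K := by
  refine restore4 hT hg hv ?_
  have hlt : Set.ncard {w | w ∈ D ∧ G.Adj v w ∧ w ∉ K} < Set.ncard {w | w ∈ D ∧ G.Adj v w} := by
    refine Set.ncard_lt_ncard ⟨fun y hy => ⟨hy.1, hy.2.1⟩, fun h => ?_⟩ (Set.toFinite _)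
    exact (h (show w ∈ {w | w ∈ D ∧ G.Adj v w} from ⟨hg.1 hw, hvw⟩)).2.2 hw
  omega

/-- Restoring a vertex with at most five already colored neighbors. -/
theorem restore5' [Fintype V] (hT : IsPlaneTriangulation G σ) {k : Fin 5} {D K : Set V}
    (hg : Good G k D K) {v : V} (hv : v ∉ D)
    (hcard : Set.ncard {w | w ∈ D ∧ G.Adj v w} ≤ 5) :
    Good G k (insert v D) K ∨ Good G k (insert v D) (insert v K) := by
  by_cases h : ∃ w ∈ K, G.Adj v w
  · obtain ⟨w, hw, hvw⟩ := h
    exact Or.inl (restore5 hT hg hv hcard hw hvw)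
  · push Not at h
    exact Or.inr (extend_k hg hv h)

end kempe


section red
variable {G : SimpleGraph V} {σ : Equiv.Perm G.Dart}

theorem start_good [Fintype V] (hG : IsMinimalCounterexample G σ) (S : Set V) (hS : S.Nonempty) :
    ∃ k K, Good G k Sᶜ K ∧ 6 * K.ncard + S.ncard ≤ Fintype.card V := by
  classical
  obtain ⟨hT, -, hmin⟩ := hG
  let W := {y : V // y ∈ Sᶜ}
  have hcard : Fintype.card W + S.ncard = Fintype.card V := by
    have h1 := Set.ncard_add_ncard_compl S
    have h2 : Fintype.card W = (Sᶜ).ncard := by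
      rw [← Nat.card_coe_set_eq, Nat.card_eq_fintype_card]
    rw [Nat.card_eq_fintype_card] at h1
    omega
  have hSpos : 0 < S.ncard := (Set.ncard_pos).2 hS
  obtain ⟨c, hc, k, hk⟩ := hmin W (G.comap (Subtype.val : W → V))
    ⟨V, inferInstance, G, σ, hT, ⟨Subtype.val, fun h => h⟩, Subtype.val_injective⟩ (by omega)
  let f : V → Fin 5 := fun y => if h : y ∈ Sᶜ then c ⟨y, h⟩ else 0
  refine ⟨k, {y | y ∈ Sᶜ ∧ f y = k}, ⟨fun y hy => hy.1, f, ⟨?_, ?_⟩⟩, ?_⟩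
  · intro u hu w hw huw
    have : c ⟨u, hu⟩ ≠ c ⟨w, hw⟩ := hc (show (G.comap (Subtype.val : W → V)).Adj _ _ from huw)
    simp only [f, dif_pos hu, dif_pos hw]
    exact this
  · intro w hw
    exact ⟨fun e => ⟨hw, e⟩, fun e => e.2⟩
  · have : Set.ncard {y | y ∈ Sᶜ ∧ f y = k} ≤ Nat.card {w : W | c w = k} := by
      have himg : {y | y ∈ Sᶜ ∧ f y = k} = Subtype.val '' {w : W | c w = k} := by
        ext y
        constructor
        · rintro ⟨hy, e⟩
          refine ⟨⟨y, hy⟩, ?_, rfl⟩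
          simp only [f, dif_pos hy] at e
          exact e
        · rintro ⟨⟨z, hz⟩, e, rfl⟩
          refine ⟨hz, ?_⟩
          simp only [f, dif_pos hz]
          exact e
      rw [himg, Set.ncard_image_of_injective _ Subtype.val_injective]
      exact le_of_eq (Nat.card_coe_set_eq _).symm
    omega

theorem end_good [Fintype V] (hG : IsMinimalCounterexample G σ) {k : Fin 5} {D K : Set V}
    (hg : Good G k D K) (hD : ∀ y, y ∈ D) (hK : 6 * K.ncard ≤ Fintype.card V) : False := by
  obtain ⟨-, f, hf⟩ := hg
  refine hG.2.1 ⟨f, fun u w h => hf.proper u (hD u) w (hD w) h, k, ?_⟩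
  have : {v | f v = k} = K := by
    ext y
    exact hf.cls y (hD y)
  rw [this, Nat.card_coe_set_eq]
  exact hK

theorem deg_ncard (v : V) : deg G v = Set.ncard {w | G.Adj v w} := by
  rw [deg, Nat.card_coe_set_eq]
  rfl

theorem back_count [Finite V] {v : V} {D M : Set V} {d m : ℕ} (hd : deg G v ≤ d)
    (hM : ∀ y ∈ M, G.Adj v y ∧ y ∉ D) (hm : m ≤ M.ncard) :
    Set.ncard {w | w ∈ D ∧ G.Adj v w} ≤ d - m := by
  rw [deg_ncard] at hd
  have hdis : Disjoint {w | w ∈ D ∧ G.Adj v w} M :=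
    Set.disjoint_left.2 fun y hy hyM => (hM y hyM).2 hy.1
  have h1 := Set.ncard_union_eq hdis (Set.toFinite _) (Set.toFinite _)
  have h2 : ({w | w ∈ D ∧ G.Adj v w} ∪ M).ncard ≤ Set.ncard {w | G.Adj v w} := by
    refine Set.ncard_le_ncard ?_ (Set.toFinite _)
    rintro y (hy | hy)
    · exact hy.2
    · exact (hM y hy).1
  omega

theorem min_deg [Fintype V] (hG : IsMinimalCounterexample G σ) (v : V) : 5 ≤ deg G v := by
  by_contra hlt
  obtain ⟨k, K, hg, hK⟩ := start_good hG {v} ⟨v, rfl⟩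
  have hg' : Good G k (insert v ({v}ᶜ)) K := restore4' hG.1 hg (fun h => h rfl)
    (back_count (M := ∅) (d := 4) (m := 0) (by omega) (by simp) (by simp))
  refine end_good hG hg' ?_ (by omega)
  intro y
  by_cases h : y = v
  · exact Or.inl h
  · exact Or.inr h

/-- The main reduction. -/
theorem main_red [Fintype V] (hG : IsMinimalCounterexample G σ) {x u1 u2 u3 u4 w : V}
    (hx : deg G x ≤ 7) (d1 : deg G u1 ≤ 5) (d2 : deg G u2 ≤ 5) (d3 : deg G u3 ≤ 5)
    (d4 : deg G u4 ≤ 5) (a1 : G.Adj x u1) (a2 : G.Adj x u2) (a3 : G.Adj x u3) (a4 : G.Adj x u4)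
    (h12 : G.Adj u1 u2) (h23 : G.Adj u2 u3) (h34 : G.Adj u3 u4)
    (n13 : u1 ≠ u3) (n14 : u1 ≠ u4) (n24 : u2 ≠ u4)
    (hw : G.Adj u1 w) (wx : w ≠ x) (w2 : w ≠ u2) (w3 : w ≠ u3) (w4 : w ≠ u4)
    (hd : deg G w ≤ 6 ∨ (deg G w ≤ 7 ∧ (G.Adj x w ∨ G.Adj u2 w))) : False := by
  have hT := hG.1
  have n12 := h12.ne
  have n23 := h23.ne
  have n34 := h34.ne
  have x1 := a1.ne
  have x2 := a2.ne
  have x3 := a3.ne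
  have x4 := a4.ne
  have w1 := hw.ne
  let S : Set V := {w, x, u4, u3, u2, u1}
  have hScard : S.ncard = 6 := by
    classical
    have : S = ((({w, x, u4, u3, u2, u1} : Finset V)) : Set V) := by simp [S]
    rw [this, Set.ncard_coe_finset]
    simp [Finset.card_insert_of_notMem, wx, w2, w3, w4, x1, x2, x3, x4, n12.symm, n13.symm,
      n14.symm, n23.symm, n24.symm, n34.symm, w1.symm]
  obtain ⟨k, K, hg, hK⟩ := start_good hG S ⟨w, by simp [S]⟩
  have rw5 : Set.ncard {y | y ∈ Sᶜ ∧ G.Adj w y} ≤ 5 := by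
    rcases hd with hd | ⟨hd, h⟩
    · refine back_count (M := {u1}) (m := 1) hd ?_ (by simp)
      rintro y rfl
      exact ⟨hw.symm, by simp [S]⟩
    · rcases h with h | h
      · refine back_count (M := {u1, x}) (m := 2) hd ?_ (by rw [Set.ncard_pair x1.symm])
        rintro y (rfl | rfl)
        · exact ⟨hw.symm, by simp [S]⟩
        · exact ⟨h.symm, by simp [S]⟩
      · refine back_count (M := {u1, u2}) (m := 2) hd ?_ (by rw [Set.ncard_pair n12])
        rintro y (rfl | rfl)
        · exact ⟨hw.symm, by simp [S]⟩
        · exact ⟨h.symm, by simp [S]⟩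
  have step : ∀ K', Good G k (insert w Sᶜ) K' →
      Good G k (insert u2 (insert u3 (insert u4 (insert x (insert w Sᶜ))))) K' := by
    intro K' hg
    have hg := restore4' hT (v := x) hg (by simp [S, wx.symm]) (by
      have := back_count (G := G) (v := x) (D := insert w Sᶜ) (M := {u1, u2, u3}) (m := 3) hx ?_
        (by rw [Set.ncard_eq_three.2 ⟨u1, u2, u3, n12, n13, n23, rfl⟩])
      · exact this
      · rintro y (rfl | rfl | rfl)
        · exact ⟨a1, by simp [S, w1]⟩
        · exact ⟨a2, by simp [S, w2.symm]⟩
        · exact ⟨a3, by simp [S, w3.symm]⟩)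
    have hg := restore4' hT (v := u4) hg (by simp [S, x4.symm, w4.symm]) (by
      refine back_count (M := {u3}) (m := 1) d4 ?_ (by simp)
      rintro y rfl
      exact ⟨h34.symm, by simp [S, w3.symm, x3.symm]⟩)
    have hg := restore4' hT (v := u3) hg (by simp [S, x3.symm, w3.symm, n34]) (by
      refine back_count (M := {u2}) (m := 1) d3 ?_ (by simp)
      rintro y rfl
      exact ⟨h23.symm, by simp [S, w2.symm, x2.symm, n24]⟩)
    exact restore4' hT (v := u2) hg (by simp [S, x2.symm, w2.symm, n24, n23]) (by
      refine back_count (M := {u1}) (m := 1) d2 ?_ (by simp)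
      rintro y rfl
      exact ⟨h12.symm, by simp [S, w1, x1.symm, n14, n13]⟩)
  have hu1 : u1 ∉ (insert u2 (insert u3 (insert u4 (insert x (insert w Sᶜ))))) := by
    simp [S, w1, x1.symm, n12, n13, n14]
  have hfull : ∀ y, y ∈ insert u1 (insert u2 (insert u3 (insert u4 (insert x (insert w Sᶜ))))) := by
    intro y
    simp only [Set.mem_insert_iff, Set.mem_compl_iff, S, Set.mem_singleton_iff]
    tauto
  have r1 : Set.ncard {y | y ∈ insert u2 (insert u3 (insert u4 (insert x (insert w Sᶜ)))) ∧
      G.Adj u1 y} ≤ 5 :=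
    back_count (M := ∅) (m := 0) d1 (by simp) (by simp)
  have hins : ∀ y, (insert y K).ncard ≤ K.ncard + 1 := fun y => Set.ncard_insert_le y K
  rcases restore5' hT hg (v := w) (by simp [S]) rw5 with hg | hg
  · rcases restore5' hT (step _ hg) hu1 r1 with hg | hg
    · exact end_good hG hg hfull (by omega)
    · exact end_good hG hg hfull (by have := hins u1; omega)
  · exact end_good hG (restore5 hT (step _ hg) hu1 r1 (Set.mem_insert _ _) hw) hfull
      (by have := hins w; omega)

end red


section wheels
variable {G : SimpleGraph V} {σ : Equiv.Perm G.Dart}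

/-- `p` and `q` are consecutive around `v`. -/
def Cons (σ : Equiv.Perm G.Dart) (v p q : V) : Prop := nx σ v p = q ∨ nx σ v q = p

theorem Cons.swap {v p q : V} (h : Cons σ v p q) : Cons σ v q p := Or.symm h

theorem Cons.rot [Fintype V] (hT : IsPlaneTriangulation G σ) {v p q : V} (hp : G.Adj v p)
    (hq : G.Adj v q) (h : Cons σ v p q) : Cons σ p q v := by
  rcases h with h | h
  · exact Or.inl (nx_face hT hp h).2.2
  · exact Or.inr (nx_face hT hq h).2.1

theorem deg_three [Finite V] (hR : IsRotationSystem G σ) {v p q r : V} (hp : G.Adj v p)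
    (h1 : nx σ v p = q) (h2 : nx σ v q = r) (h3 : nx σ v r = p) : deg G v ≤ 3 := by
  by_contra hlt
  have := iter_inj hR hp (i := 3) (j := 0) (by omega) (by omega)
    (by simp [Function.iterate_succ_apply', h1, h2, h3])
  omega

theorem deg_four [Finite V] (hR : IsRotationSystem G σ) {v p q r s : V} (hp : G.Adj v p)
    (h1 : nx σ v p = q) (h2 : nx σ v q = r) (h3 : nx σ v r = s) (h4 : nx σ v s = p) :
    deg G v ≤ 4 := by
  by_contra hlt
  have := iter_inj hR hp (i := 4) (j := 0) (by omega) (by omega)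
    (by simp [Function.iterate_succ_apply', h1, h2, h3, h4])
  omega

theorem three_cons [Finite V] (hR : IsRotationSystem G σ) {v p q r : V} (hp : G.Adj v p)
    (hq : G.Adj v q) (hr : G.Adj v r) (npq : p ≠ q) (nqr : q ≠ r) (nrp : r ≠ p)
    (h1 : Cons σ v p q) (h2 : Cons σ v q r) (h3 : Cons σ v r p) : deg G v ≤ 3 := by
  rcases h1 with h1 | h1 <;> rcases h2 with h2 | h2
  · rcases h3 with h3 | h3
    · exact deg_three hR hp h1 h2 h3
    · exact absurd (h1.symm.trans h3) nqr
  · exact absurd (nx_inj hR hp hr (h1.trans h2.symm)) nrp.symm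
  · exact absurd (h1.symm.trans h2) nrp.symm
  · rcases h3 with h3 | h3
    · exact absurd (h3.symm.trans h2) npq
    · exact deg_three hR hp h3 h2 h1

theorem cons_next (hR : IsRotationSystem G σ) {v p q r : V} (hp : G.Adj v p)
    (hr : G.Adj v r) (nrp : r ≠ p) (h1 : nx σ v p = q) (h2 : Cons σ v q r) : nx σ v q = r := by
  rcases h2 with h2 | h2
  · exact h2
  · exact absurd (nx_inj hR hp hr (h1.trans h2.symm)) nrp.symm

theorem four_cons [Finite V] (hR : IsRotationSystem G σ) {v p q r s : V} (hp : G.Adj v p)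
    (hq : G.Adj v q) (hr : G.Adj v r) (hs : G.Adj v s) (npr : p ≠ r) (nqs : q ≠ s)
    (h1 : Cons σ v p q) (h2 : Cons σ v q r) (h3 : Cons σ v r s) (h4 : Cons σ v s p) :
    deg G v ≤ 4 := by
  rcases h1 with h1 | h1
  · have e2 := cons_next hR hp hr npr.symm h1 h2
    have e3 := cons_next hR hq hs nqs.symm e2 h3
    have e4 := cons_next hR hr hp npr e3 h4
    exact deg_four hR hp h1 e2 e3 e4
  · have e2 := cons_next hR hq hs nqs.symm h1 h4.swap
    have e3 := cons_next hR hp hr npr.symm e2 h3.swap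
    have e4 := cons_next hR hs hq nqs e3 h2.swap
    exact deg_four hR hq h1 e2 e3 e4

theorem link5 [Finite V] (hR : IsRotationSystem G σ) {v a : V} (ha : G.Adj v a)
    (hd : deg G v = 5) : ∃ b c d e, nx σ v a = b ∧ nx σ v b = c ∧ nx σ v c = d ∧ nx σ v d = e ∧
      nx σ v e = a ∧ G.Adj v b ∧ G.Adj v c ∧ G.Adj v d ∧ G.Adj v e ∧
      a ≠ b ∧ a ≠ c ∧ a ≠ d ∧ a ≠ e ∧ b ≠ c ∧ b ≠ d ∧ b ≠ e ∧ c ≠ d ∧ c ≠ e ∧ d ≠ e ∧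
      ∀ y, G.Adj v y → y = a ∨ y = b ∨ y = c ∨ y = d ∨ y = e := by
  have hne : ∀ i j, i < 5 → j < 5 → i ≠ j → (nx σ v)^[i] a ≠ (nx σ v)^[j] a :=
    fun i j hi hj h e => h (iter_inj hR ha (by omega) (by omega) e)
  refine ⟨(nx σ v)^[1] a, (nx σ v)^[2] a, (nx σ v)^[3] a, (nx σ v)^[4] a, rfl,
    rfl, rfl, rfl, ?_, adj_iter hR ha 1, adj_iter hR ha 2, adj_iter hR ha 3, adj_iter hR ha 4,
    hne 0 1 (by omega) (by omega) (by omega), hne 0 2 (by omega) (by omega) (by omega),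
    hne 0 3 (by omega) (by omega) (by omega), hne 0 4 (by omega) (by omega) (by omega),
    hne 1 2 (by omega) (by omega) (by omega), hne 1 3 (by omega) (by omega) (by omega),
    hne 1 4 (by omega) (by omega) (by omega), hne 2 3 (by omega) (by omega) (by omega),
    hne 2 4 (by omega) (by omega) (by omega), hne 3 4 (by omega) (by omega) (by omega), ?_⟩
  · have := iter_deg hR ha
    rwa [hd] at this
  · intro y hy
    obtain ⟨i, hi, rfl⟩ := iter_surj hR ha hy
    rw [hd] at hi
    interval_cases i <;> simp

theorem fifth : ∀ a b c k : Fin 5, ∃ i, i ≠ a ∧ i ≠ b ∧ i ≠ c ∧ i ≠ k := by decide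

/-- A vertex of degree 5 cannot have link `B C s A t` with `A` adjacent to `B` and `C`. -/
theorem bad_k4 [Fintype V] (hG : IsMinimalCounterexample G σ) {c A B C s t : V}
    (hd : deg G c = 5) (hB : G.Adj c B) (e1 : nx σ c B = C) (e2 : nx σ c C = s)
    (e3 : nx σ c s = A) (e4 : nx σ c A = t) (e5 : nx σ c t = B) (hAB : G.Adj A B)
    (hAC : G.Adj A C) : False := by
  have hT := hG.1
  have hR := hT.rot
  have hC : G.Adj c C := e1 ▸ adj_nx hR hB
  have hs : G.Adj c s := e2 ▸ adj_nx hR hC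
  have hA : G.Adj c A := e3 ▸ adj_nx hR hs
  have ht : G.Adj c t := e4 ▸ adj_nx hR hA
  have hBC : G.Adj B C := (nx_face hT hB e1).1
  have hCs : G.Adj C s := (nx_face hT hC e2).1
  have hsA : G.Adj s A := (nx_face hT hs e3).1
  have hAt : G.Adj A t := (nx_face hT hA e4).1
  have htB : G.Adj t B := (nx_face hT ht e5).1
  have hall : ∀ y, G.Adj c y → y = B ∨ y = C ∨ y = s ∨ y = A ∨ y = t := by
    intro y hy
    obtain ⟨i, hi, rfl⟩ := iter_surj hR hB hy
    rw [hd] at hi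
    interval_cases i <;> simp [Function.iterate_succ_apply', e1, e2, e3, e4]
  have mem : ∀ {y}, G.Adj c y → y ∈ ({c}ᶜ : Set V) := fun h e => h.ne (Eq.symm e)
  have cn : c ∉ ({c}ᶜ : Set V) := fun h => h rfl
  obtain ⟨k, K, hg, hK⟩ := start_good hG {c} ⟨c, rfl⟩
  have hend : Good G k (insert c ({c}ᶜ)) K → False := fun h =>
    end_good hG h (fun y => by by_cases h : y = c; exacts [Or.inl h, Or.inr h]) (by omega)
  have hnK : ∀ w ∈ K, ¬ G.Adj c w := fun w hw h => hend (restore5 hT hg cn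
    (back_count (M := ∅) (d := 5) (m := 0) hd.le (by simp) (by simp)) hw h)
  obtain ⟨hKD, f, hf⟩ := hg
  have nk : ∀ {f : V → Fin 5}, ColOn G k {c}ᶜ K f → ∀ {y}, G.Adj c y → f y ≠ k :=
    fun hf y hy e => hnK y ((hf.cls y (mem hy)).1 e) hy
  have pr : ∀ {f : V → Fin 5}, ColOn G k {c}ᶜ K f → ∀ {y z}, G.Adj c y → G.Adj c z →
    G.Adj y z → f y ≠ f z := fun hf y z hy hz h => hf.proper y (mem hy) z (mem hz) h
  have cnP : ∀ {f : V → Fin 5} {i j}, c ∉ twoCol {c}ᶜ f i j := fun h => cn h.1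
  -- final stage
  have fin : ∀ f : V → Fin 5, ColOn G k {c}ᶜ K f → f s = f B → f t = f C → False := by
    intro f hf h1 h2
    obtain ⟨i, ia, ib, ic, ik⟩ := fifth (f A) (f B) (f C) k
    refine hend (extend_free hf hKD cn ik fun w _ hw => ?_)
    rcases hall w hw with rfl | rfl | rfl | rfl | rfl
    · exact ib.symm
    · exact ic.symm
    · rw [h1]; exact ib.symm
    · exact ia.symm
    · rw [h2]; exact ic.symm
  -- second stage
  have mid : ∀ f : V → Fin 5, ColOn G k {c}ᶜ K f → f s = f B → False := by
    intro f hf h1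
    by_cases h2 : f t = f C
    · exact fin f hf h1 h2
    have hch : ¬ Relation.ReflTransGen (adjIn G (twoCol {c}ᶜ f (f t) (f C))) t C := by
      intro hch
      refine crossing hT ht (j := 1) (k := 2) (l := 4) (by omega) (by omega) (by omega)
        (by omega) (twoCol {c}ᶜ f (f t) (f C)) {B, A} ?_ cnP ?_ ?_ ?_
      · rintro y ⟨-, hy⟩ (rfl | rfl)
        · rcases hy with hy | hy
          · exact pr hf ht hB htB hy.symm
          · exact pr hf hB hC hBC hy
        · rcases hy with hy | hy
          · exact pr hf hA ht hAt hy
          · exact pr hf hA hC hAC hy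
      · rintro (h | h)
        · exact hB.ne h
        · exact hA.ne h
      · simpa [Function.iterate_succ_apply', e5, e1] using hch
      · simp only [Function.iterate_succ_apply', Function.iterate_zero, id, e5, e1, e2, e3]
        exact Relation.ReflTransGen.single ⟨hAB.symm, by simp, by simp⟩
    obtain ⟨f', hf', h3, h4, h5⟩ := swap_free hf (mem ht) h2 (nk hf ht) (nk hf hC) hch
    refine fin f' hf' ?_ (h3.trans h4.symm)
    have hBt : f B ≠ f t := (pr hf ht hB htB).symm
    have hBC' : f B ≠ f C := pr hf hB hC hBC
    rw [h5 B hBt hBC', h5 s (h1 ▸ hBt) (h1 ▸ hBC'), h1]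
  by_cases h1 : f s = f B
  · exact mid f hf h1
  have hch : ¬ Relation.ReflTransGen (adjIn G (twoCol {c}ᶜ f (f s) (f B))) s B := by
    intro hch
    refine crossing hT hs (j := 1) (k := 3) (l := 4) (by omega) (by omega) (by omega)
      (by omega) (twoCol {c}ᶜ f (f s) (f B)) {A, C} ?_ cnP ?_ ?_ ?_
    · rintro y ⟨-, hy⟩ (rfl | rfl)
      · rcases hy with hy | hy
        · exact pr hf hs hA hsA hy.symm
        · exact pr hf hA hB hAB hy
      · rcases hy with hy | hy
        · exact pr hf hC hs hCs hy
        · exact pr hf hB hC hBC hy.symm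
    · rintro (h | h)
      · exact hA.ne h
      · exact hC.ne h
    · simpa [Function.iterate_succ_apply', e3, e4, e5] using hch
    · simp only [Function.iterate_succ_apply', Function.iterate_zero, id, e3, e4, e5, e1]
      exact Relation.ReflTransGen.single ⟨hAC, by simp, by simp⟩
  obtain ⟨f', hf', h3, h4, h5⟩ := swap_free hf (mem hs) h1 (nk hf hs) (nk hf hB) hch
  exact mid f' hf' (h3.trans h4.symm)

/-- Three mutually adjacent neighbors of a vertex of degree 5: two pairs are consecutive. -/
theorem two_faces [Fintype V] (hG : IsMinimalCounterexample G σ) {c A B C : V}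
    (hd : deg G c = 5) (hA : G.Adj c A) (hB : G.Adj c B) (hC : G.Adj c C) (hAB : G.Adj A B)
    (hBC : G.Adj B C) (hCA : G.Adj C A) :
    (Cons σ c A B ∧ Cons σ c B C) ∨ (Cons σ c B C ∧ Cons σ c C A) ∨
      (Cons σ c C A ∧ Cons σ c A B) := by
  obtain ⟨b1, b2, b3, b4, e1, e2, e3, e4, e5, a1, a2, a3, a4, -, -, -, -, -, -, -, -, -, -, hall⟩ :=
    link5 hG.1.rot hA hd
  rcases hall B hB with rfl | rfl | rfl | rfl | rfl
  · exact absurd hAB (G.loopless.irrefl _)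
  all_goals rcases hall C hC with rfl | rfl | rfl | rfl | rfl
  all_goals first
    | exact absurd hBC (G.loopless.irrefl _)
    | exact absurd hCA (G.loopless.irrefl _)
    | (simp only [Cons, e1, e2, e3, e4, e5]; simp; done)
    | exact (bad_k4 hG hd ‹_› ‹_› ‹_› ‹_› ‹_› ‹_› hAB hCA.symm).elim
    | exact (bad_k4 hG hd ‹_› ‹_› ‹_› ‹_› ‹_› ‹_› hCA.symm hAB).elim
    | exact (bad_k4 hG hd ‹_› ‹_› ‹_› ‹_› ‹_› ‹_› hBC hAB.symm).elim
    | exact (bad_k4 hG hd ‹_› ‹_› ‹_› ‹_› ‹_› ‹_› hAB.symm hBC).elim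
    | exact (bad_k4 hG hd ‹_› ‹_› ‹_› ‹_› ‹_› ‹_› hCA hBC.symm).elim
    | exact (bad_k4 hG hd ‹_› ‹_› ‹_› ‹_› ‹_› ‹_› hBC.symm hCA).elim

end wheels


section wheels2
variable {G : SimpleGraph V} {σ : Equiv.Perm G.Dart}

theorem no_k4 [Fintype V] (hG : IsMinimalCounterexample G σ) {x a b e : V}
    (da : deg G a = 5) (db : deg G b = 5) (de : deg G e = 5) (xa : G.Adj x a) (xb : G.Adj x b)
    (xe : G.Adj x e) (ab : G.Adj a b) (be : G.Adj b e) (ea : G.Adj e a) : False := by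
  have hT := hG.1
  have hR := hT.rot
  have hmin := min_deg hG
  have key : ∀ p q r : V, G.Adj p q → G.Adj p r → Cons σ p q r → Cons σ q r p :=
    fun p q r h1 h2 h => h.rot hT h1 h2
  have three : ∀ v p q r : V, G.Adj v p → G.Adj v q → G.Adj v r → G.Adj p q → G.Adj q r →
      G.Adj r p → Cons σ v p q → Cons σ v q r → Cons σ v r p → False := by
    intro v p q r h1 h2 h3 h4 h5 h6 c1 c2 c3
    have := three_cons hR h1 h2 h3 h4.ne h5.ne h6.ne c1 c2 c3
    have := hmin v
    omega
  -- the four possible faces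
  have Ta := two_faces hG da xa.symm ab ea.symm xb be xe.symm
  have Tb := two_faces hG db xb.symm be ab.symm xe ea xa.symm
  have Te := two_faces hG de xe.symm ea be.symm xa ab xb.symm
  have b1 : Cons σ b a x → Cons σ a x b := key _ _ _ ab.symm xb.symm
  have b2 : Cons σ a x b → Cons σ x b a := key _ _ _ xa.symm ab
  have b3 : Cons σ x b a → Cons σ b a x := key _ _ _ xb xa
  have c1 : Cons σ e b x → Cons σ b x e := key _ _ _ be.symm xe.symm
  have c2 : Cons σ b x e → Cons σ x e b := key _ _ _ xb.symm be
  have c3 : Cons σ x e b → Cons σ e b x := key _ _ _ xe xb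
  have d1 : Cons σ a e x → Cons σ e x a := key _ _ _ ea.symm xa.symm
  have d2 : Cons σ e x a → Cons σ x a e := key _ _ _ xe.symm ea
  have d3 : Cons σ x a e → Cons σ a e x := key _ _ _ xa xe
  have f1 : Cons σ a b e → Cons σ b e a := key _ _ _ ab ea.symm
  have f2 : Cons σ b e a → Cons σ e a b := key _ _ _ be ab.symm
  have f3 : Cons σ e a b → Cons σ a b e := key _ _ _ ea be.symm
  have tx : ¬ (Cons σ x b a ∧ Cons σ x e b ∧ Cons σ x a e) := fun ⟨p, q, r⟩ =>
    three x b a e xb xa xe ab.symm ea.symm be.symm p r q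
  have ta : ¬ (Cons σ a x b ∧ Cons σ a b e ∧ Cons σ a e x) := fun ⟨p, q, r⟩ =>
    three a x b e xa.symm ab ea.symm xb be xe.symm p q r
  have tb : ¬ (Cons σ b x e ∧ Cons σ b e a ∧ Cons σ b a x) := fun ⟨p, q, r⟩ =>
    three b x e a xb.symm be ab.symm xe ea xa.symm p q r
  have te : ¬ (Cons σ e x a ∧ Cons σ e a b ∧ Cons σ e b x) := fun ⟨p, q, r⟩ =>
    three e x a b xe.symm ea be.symm xa ab xb.symm p q r
  have i1 : Cons σ a x b ↔ Cons σ x b a := ⟨b2, fun h => b1 (b3 h)⟩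
  have i2 : Cons σ b a x ↔ Cons σ x b a := ⟨fun h => b2 (b1 h), b3⟩
  have i3 : Cons σ b x e ↔ Cons σ x e b := ⟨c2, fun h => c1 (c3 h)⟩
  have i4 : Cons σ e b x ↔ Cons σ x e b := ⟨fun h => c2 (c1 h), c3⟩
  have i5 : Cons σ e x a ↔ Cons σ x a e := ⟨d2, fun h => d1 (d3 h)⟩
  have i6 : Cons σ a e x ↔ Cons σ x a e := ⟨fun h => d2 (d1 h), d3⟩
  have i7 : Cons σ b e a ↔ Cons σ a b e := ⟨fun h => f3 (f2 h), f1⟩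
  have i8 : Cons σ e a b ↔ Cons σ a b e := ⟨f3, fun h => f2 (f1 h)⟩
  rw [i1, i6] at Ta ta
  rw [i3, i7, i2] at Tb tb
  rw [i5, i8, i4] at Te te
  clear key three b1 b2 b3 c1 c2 c3 d1 d2 d3 f1 f2 f3 i1 i2 i3 i4 i5 i6 i7 i8
  generalize Cons σ x b a = P1 at *
  generalize Cons σ x e b = P2 at *
  generalize Cons σ x a e = P3 at *
  generalize Cons σ a b e = P0 at *
  by_cases p0 : P0 <;> by_cases p1 : P1 <;> by_cases p2 : P2 <;> by_cases p3 : P3 <;>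
    simp only [p0, p1, p2, p3] at Ta Tb Te tx ta tb te <;> simp at Ta Tb Te tx ta tb te

theorem link_pos [Fintype V] (hT : IsPlaneTriangulation G σ) {u x p q : V} (hd : deg G u = 5)
    (hx : G.Adj u x) (hp : G.Adj u p) (hq : G.Adj u q) (xp : G.Adj x p) (xq : G.Adj x q)
    (hpq : ¬ G.Adj p q) (npq : p ≠ q) (hc : ¬ Cons σ u x q) :
    (∃ o o', nx σ u x = p ∧ nx σ u p = o ∧ nx σ u o = q ∧ nx σ u q = o' ∧ nx σ u o' = x) ∨
    (∃ o o', nx σ u x = o' ∧ nx σ u o' = q ∧ nx σ u q = o ∧ nx σ u o = p ∧ nx σ u p = x) := by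
  obtain ⟨b1, b2, b3, b4, e1, e2, e3, e4, e5, a1, a2, a3, a4, -, -, -, -, -, -, -, -, -, -, hall⟩ :=
    link5 hT.rot hx hd
  have hpq1 : nx σ u p ≠ q := fun e => hpq (nx_face hT hp e).1
  have hpq2 : nx σ u q ≠ p := fun e => hpq (nx_face hT hq e).1.symm
  have hc1 : nx σ u x ≠ q := fun e => hc (Or.inl e)
  have hc2 : nx σ u q ≠ x := fun e => hc (Or.inr e)
  rcases hall p hp with rfl | rfl | rfl | rfl | rfl
  · exact absurd rfl xp.ne
  all_goals rcases hall q hq with rfl | rfl | rfl | rfl | rfl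
  all_goals first
    | exact absurd rfl xq.ne
    | exact absurd rfl npq
    | exact absurd e1 hc1
    | exact absurd e5 hc2
    | exact absurd ‹_› hpq1
    | exact absurd ‹_› hpq2
    | exact Or.inl ⟨_, _, e1, e2, e3, e4, e5⟩
    | exact Or.inr ⟨_, _, e1, e2, e3, e4, e5⟩

theorem wheel_bad [Fintype V] (hG : IsMinimalCounterexample G σ) {x p u q r : V}
    (du : deg G u = 5) (dq : deg G q = 5) (xp : G.Adj x p) (xu : G.Adj x u)
    (xq : G.Adj x q) (xr : G.Adj x r) (pu : G.Adj p u) (uq : G.Adj u q) (qr : G.Adj q r)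
    (rp : G.Adj r p) (npq : ¬ G.Adj p q) (pq : p ≠ q) (nur : ¬ G.Adj u r) (ur : u ≠ r)
    (hc : ¬ Cons σ u x q) : False := by
  have hT := hG.1
  have hR := hT.rot
  have hc' : ¬ Cons σ q x u := fun h => hc ((h.swap.rot hT uq.symm xq.symm).swap.swap)
  have small : ∀ o, G.Adj o x → deg G o ≤ 3 → False := fun o _ h => by
    have := min_deg hG o
    omega
  have path : ∀ o, o ≠ x → o ≠ q → G.Adj r o → G.Adj u o → ∀ j k l : ℕ, 0 < j → j < k → k < l →
      l < 5 → (nx σ u)^[k] x = q → (((nx σ u)^[j] x = p ∧ (nx σ u)^[l] x = o) ∨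
        ((nx σ u)^[j] x = o ∧ (nx σ u)^[l] x = p)) → False := by
    intro o ox oq ro uo j k l h0 h1 h2 h3 hq h
    refine crossing hT xu.symm (j := j) (k := k) (l := l) h0 h1 h2 (by omega) {x, q} {p, r, o}
      ?_ ?_ ?_ ?_ ?_
    · rintro y (rfl | rfl) (h | h | h)
      · exact xp.ne h
      · exact xr.ne h
      · exact ox h.symm
      · exact pq h.symm
      · exact qr.ne h
      · exact oq h.symm
    · rintro (h | h)
      · exact xu.ne h.symm
      · exact uq.ne h
    · rintro (h | h | h)
      · exact pu.ne h.symm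
      · exact ur h
      · exact uo.ne h
    · rw [hq]
      exact Relation.ReflTransGen.single ⟨xq, by simp, by simp⟩
    · rcases h with ⟨h, h'⟩ | ⟨h, h'⟩ <;> rw [h, h']
      · have s1 : adjIn G {p, r, o} p r := ⟨rp.symm, by simp, by simp⟩
        have s2 : adjIn G {p, r, o} r o := ⟨ro, by simp, by simp⟩
        exact Relation.ReflTransGen.head s1 (Relation.ReflTransGen.single s2)
      · have s1 : adjIn G {p, r, o} o r := ⟨ro.symm, by simp, by simp⟩
        have s2 : adjIn G {p, r, o} r p := ⟨rp, by simp, by simp⟩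
        exact Relation.ReflTransGen.head s1 (Relation.ReflTransGen.single s2)
  rcases link_pos hT du xu.symm pu.symm uq xp xq npq pq hc with
    ⟨o, o', a1, a2, a3, a4, a5⟩ | ⟨o, o', a1, a2, a3, a4, a5⟩ <;>
  rcases link_pos hT dq xq.symm qr uq.symm xr xu (fun h => nur h.symm) ur.symm hc' with
    ⟨e, e', b1, b2, b3, b4, b5⟩ | ⟨e, e', b1, b2, b3, b4, b5⟩
  · skip
    have hqe : G.Adj q e := b2 ▸ adj_nx hR qr
    obtain ⟨h1, h2, h3⟩ := nx_face hT uq a4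
    have he : e = o' := nx_inj hR hqe h1 (b3.trans h3.symm)
    subst he
    have hue : G.Adj u e := a4 ▸ adj_nx hR uq
    refine path e ?_ hqe.ne.symm (nx_face hT qr b2).1 hue 1 3 4 (by omega) (by omega) (by omega)
      (by omega) (by simp [Function.iterate_succ_apply', a1, a2, a3])
      (Or.inl ⟨by simp [a1], by simp [Function.iterate_succ_apply', a1, a2, a3, a4]⟩)
    rintro rfl
    exact hc (Or.inr a4)
  · skip
    have hqe : G.Adj q e' := b1 ▸ adj_nx hR xq.symm
    obtain ⟨h1, h2, h3⟩ := nx_face hT uq a4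
    have he : e' = o' := nx_inj hR hqe h1 (b2.trans h3.symm)
    subst he
    have hue : G.Adj u e' := a4 ▸ adj_nx hR uq
    obtain ⟨g1, g2, g3⟩ := nx_face hT xq.symm b1
    obtain ⟨k1, k2, k3⟩ := nx_face hT hue a5
    exact small e' g1.symm (deg_three hR g1.symm k3 h2 g2)
  · skip
    have huo : G.Adj u o' := a1 ▸ adj_nx hR xu.symm
    obtain ⟨h1, h2, h3⟩ := nx_face hT huo a2
    have he : e' = o' := b4.symm.trans h2
    subst he
    have hqe : G.Adj q e' := h1.symm
    obtain ⟨g1, g2, g3⟩ := nx_face hT hqe b5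
    obtain ⟨k1, k2, k3⟩ := nx_face hT xu.symm a1
    exact small e' g1 (deg_three hR g1 g3 h3 k2)
  · skip
    have huo : G.Adj u o' := a1 ▸ adj_nx hR xu.symm
    obtain ⟨h1, h2, h3⟩ := nx_face hT huo a2
    have he : e = o' := b3.symm.trans h2
    subst he
    have hqe : G.Adj q e := h1.symm
    refine path e ?_ hqe.ne.symm (nx_face hT hqe b4).1.symm huo 1 2 4 (by omega) (by omega)
      (by omega) (by omega) (by simp [Function.iterate_succ_apply', a1, a2])
      (Or.inr ⟨by simp [a1], by simp [Function.iterate_succ_apply', a1, a2, a3, a4]⟩)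
    rintro rfl
    exact (nx_face hT xu.symm a1).1.ne rfl

theorem no_wheel [Fintype V] (hG : IsMinimalCounterexample G σ) {x a b c d : V}
    (da : deg G a = 5) (db : deg G b = 5) (dc : deg G c = 5) (dd : deg G d = 5)
    (xa : G.Adj x a) (xb : G.Adj x b) (xc : G.Adj x c) (xd : G.Adj x d)
    (ab : G.Adj a b) (bc : G.Adj b c) (cd : G.Adj c d) (da' : G.Adj d a)
    (nac : a ≠ c) (nbd : b ≠ d) : False := by
  have hT := hG.1
  have hac : ¬ G.Adj a c := fun h => no_k4 hG da db dc xa xb xc ab bc h.symm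
  have hbd : ¬ G.Adj b d := fun h => no_k4 hG db dc dd xb xc xd bc cd h.symm
  have hca : ¬ G.Adj c a := fun h => hac h.symm
  have hdb : ¬ G.Adj d b := fun h => hbd h.symm
  have c1 : Cons σ a x b := by
    by_contra h
    exact wheel_bad hG da db xd xa xb xc da' ab bc cd hdb nbd.symm hac nac h
  have c2 : Cons σ b x c := by
    by_contra h
    exact wheel_bad hG db dc xa xb xc xd ab bc cd da' hac nac hbd nbd h
  have c3 : Cons σ c x d := by
    by_contra h
    exact wheel_bad hG dc dd xb xc xd xa bc cd da' ab hbd nbd hca nac.symm h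
  have c4 : Cons σ d x a := by
    by_contra h
    exact wheel_bad hG dd da xc xd xa xb cd da' ab bc hca nac.symm hdb nbd.symm h
  have := four_cons hT.rot xa xb xc xd nac nbd (c1.rot hT xa.symm ab).swap
    (c2.rot hT xb.symm bc).swap (c3.rot hT xc.symm cd).swap (c4.rot hT xd.symm da').swap
  have := min_deg hG x
  omega

end wheels2


theorem statement13 [Fintype V] (G : SimpleGraph V) (σ : Equiv.Perm G.Dart)
    (hG : IsMinimalCounterexample G σ) (x u1 u2 u3 u4 v : V)
    (hx : deg G x = 7)
    (hdistinct : List.Nodup [u1, u2, u3, u4])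
    (hset : {u : V | G.Adj x u ∧ deg G u = 5} = {u1, u2, u3, u4})
    (h12 : G.Adj u1 u2) (h23 : G.Adj u2 u3) (h34 : G.Adj u3 u4)
    (hv : v = u1) :
    Nat.card {w : V | G.Adj v w ∧ 7 ≤ deg G w} = 4 ∧
    2 ≤ Nat.card {w : V | G.Adj v w ∧ 8 ≤ deg G w} := by
  classical
  subst hv
  have hT := hG.1
  have hmem : ∀ y, y ∈ ({v, u2, u3, u4} : Set V) → G.Adj x y ∧ deg G y = 5 := by
    intro y hy
    rw [← hset] at hy
    exact hy
  obtain ⟨a1, d1⟩ := hmem v (by simp)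
  obtain ⟨a2, d2⟩ := hmem u2 (by simp)
  obtain ⟨a3, d3⟩ := hmem u3 (by simp)
  obtain ⟨a4, d4⟩ := hmem u4 (by simp)
  have n13 : v ≠ u3 := by rintro rfl; simp at hdistinct
  have n14 : v ≠ u4 := by rintro rfl; simp at hdistinct
  have n24 : u2 ≠ u4 := by rintro rfl; simp at hdistinct
  have h13 : ¬ G.Adj v u3 := fun h => no_k4 hG d1 d2 d3 a1 a2 a3 h12 h23 h.symm
  have h14 : ¬ G.Adj v u4 := fun h =>
    no_wheel hG d1 d2 d3 d4 a1 a2 a3 a4 h12 h23 h34 h.symm n13 n24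
  have red : ∀ w, G.Adj v w → w ≠ x → w ≠ u2 →
      7 ≤ deg G w ∧ ((G.Adj x w ∨ G.Adj u2 w) → 8 ≤ deg G w) := by
    intro w hw wx w2
    have base := main_red hG hx.le d1.le d2.le d3.le d4.le a1 a2 a3 a4 h12 h23 h34 n13 n14 n24
      hw wx w2 (fun e => h13 (e ▸ hw)) (fun e => h14 (e ▸ hw))
    constructor
    · by_contra h
      exact base (Or.inl (by omega))
    · intro h8
      by_contra h
      exact base (Or.inr ⟨by omega, h8⟩)
  constructor
  · have hs : {w : V | G.Adj v w ∧ 7 ≤ deg G w} = {w | G.Adj v w} \ {u2} := by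
      ext w
      constructor
      · rintro ⟨h, h7⟩
        refine ⟨h, ?_⟩
        rintro rfl
        omega
      · rintro ⟨h, h2⟩
        refine ⟨h, ?_⟩
        by_cases hwx : w = x
        · rw [hwx, hx]
        · exact (red w h hwx h2).1
    rw [Nat.card_coe_set_eq, hs, Set.ncard_sdiff_singleton_of_mem (show u2 ∈ {w | G.Adj v w} from h12),
       ← deg_ncard, d1]
  · have two : ∀ p q, p ≠ q → G.Adj v p → G.Adj v q → p ≠ x → q ≠ x → p ≠ u2 → q ≠ u2 →
        (G.Adj x p ∨ G.Adj u2 p) → (G.Adj x q ∨ G.Adj u2 q) →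
        2 ≤ Nat.card {w : V | G.Adj v w ∧ 8 ≤ deg G w} := by
      intro p q pq hp hq px qx p2 q2 hp8 hq8
      rw [Nat.card_coe_set_eq, ← Set.ncard_pair pq]
      refine Set.ncard_le_ncard ?_ (Set.toFinite _)
      rintro y (rfl | rfl)
      · exact ⟨hp, (red _ hp px p2).2 hp8⟩
      · exact ⟨hq, (red _ hq qx q2).2 hq8⟩
    obtain ⟨b1, b2, b3, b4, e1, e2, e3, e4, e5, g1, g2, g3, g4, m1, m2, m3, m4, m12, m13, m14,
      m23, m24, m34, hall⟩ := link5 hT.rot a1.symm d1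
    have t1 := (nx_face hT a1.symm e1).1
    have t2 := (nx_face hT g1 e2).1
    have t3 := (nx_face hT g2 e3).1
    have t4 := (nx_face hT g3 e4).1
    have t5 := (nx_face hT g4 e5).1
    rcases hall u2 h12 with h | h | h | h | h
    · exact absurd h a2.ne.symm
    · subst h
      exact two b4 b2 m24.symm g4 g2 m4.symm m2.symm m14.symm m12.symm (Or.inl t5.symm)
        (Or.inr t2)
    · subst h
      exact two b1 b3 m13 g1 g3 m1.symm m3.symm m12 m23.symm (Or.inl t1) (Or.inr t3)
    · subst h
      exact two b2 b4 m24 g2 g4 m2.symm m4.symm m23 m34.symm (Or.inr t3.symm) (Or.inr t4)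
    · subst h
      exact two b1 b3 m13 g1 g3 m1.symm m3.symm m14 m34 (Or.inl t1) (Or.inr t4.symm)
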